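/- arXiv:0903.4839 — 6 statements merged into one kernel-verified Lean document; each statement's English description precedes it below -/
import Mathlib

section
/- Let K be a field, A = K[x₁,…,xₙ], φ a K-algebra endomorphism of A, and m a natural number. Then trdeg_K(image φ) = m if and only if m is the maximal length of a strictly increasing chain of kernels of endomorphisms beginning at ker φ; that is: there exist K-algebra endomorphisms ψ₀ = φ, ψ₁, …, ψ_m of A with ker ψ₀ ⊊ ker ψ₁ ⊊ ⋯ ⊊ ker ψ_m, and there exists no such chain ψ₀ = φ, ψ₁, …, ψ_{m+1} with m+1 strict inclusions. -/
open MvPolynomial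

/-- The transcendence degree of an algebra `A` over `K`: the supremum of cardinalities of
algebraically independent subsets (mirrors Mathlib's `Algebra.trdeg`). -/
noncomputable def algTrdeg (K A : Type*) [CommRing K] [CommRing A] [Algebra K A] : Cardinal :=
  ⨆ ι : { s : Set A // AlgebraicIndependent K ((↑) : s → A) }, Cardinal.mk ι.1

theorem algTrdeg_eq_trdeg (K A : Type*) [CommRing K] [CommRing A] [Algebra K A] :
    algTrdeg K A = Algebra.trdeg K A := rfl

open scoped MonomialOrder

section Trdeg

universe u

variable {K A B C : Type u} [Field K] [CommRing A] [Algebra K A] [CommRing B] [Algebra K B]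
  [CommRing C] [Algebra K C]

theorem trdeg_lt_of_surjective_of_not_injective [IsDomain B] [IsDomain C]
    (hfin : Algebra.trdeg K B < Cardinal.aleph0) (f : B →ₐ[K] C)
    (hsurj : Function.Surjective f) (hinj : ¬ Function.Injective f) :
    Algebra.trdeg K C < Algebra.trdeg K B := by
  refine (trdeg_le_of_surjective f hsurj).lt_of_ne fun heq => hinj ?_
  obtain ⟨s, hs⟩ := exists_isTranscendenceBasis K C
  have hcard := hs.cardinalMk_eq_trdeg
  choose g hg using hsurj
  have hfg : (f ∘ fun y : s => g y) = ((↑) : s → C) := funext fun y => hg y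
  have hind : AlgebraicIndependent K fun y : s => g y :=
    AlgebraicIndependent.of_comp f (by rw [hfg]; exact hs.1)
  have hbasis := hind.isTranscendenceBasis_of_trdeg_le hfin (by rw [hcard, heq])
  have halg := hbasis.isAlgebraic
  rw [injective_iff_map_eq_zero]
  intro b hb
  by_contra hb0
  refine Ideal.comap_ne_bot_of_algebraic_mem (I := RingHom.ker f) hb0 hb
    (halg.isAlgebraic b) ?_
  rw [eq_bot_iff]
  rintro ⟨a, ha⟩ (hfa : f a = 0)
  rw [Algebra.adjoin_range_eq_range_aeval] at ha
  obtain ⟨p, rfl⟩ := ha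
  have hp : aeval ((↑) : s → C) p = 0 := by
    rw [← hfg, ← hfa]
    exact (comp_aeval_apply (fun y : s => g y) f p).symm
  obtain rfl := hs.1.eq_zero_of_aeval_eq_zero p hp
  exact Subtype.ext (map_zero (aeval fun y : s => g y))

theorem exists_surjective_range_of_ker_le (f : A →ₐ[K] B) (g : A →ₐ[K] C)
    (h : RingHom.ker f ≤ RingHom.ker g) :
    ∃ π : f.range →ₐ[K] g.range, Function.Surjective π ∧
      ∀ a, π (f.rangeRestrict a) = g.rangeRestrict a := by
  have hlift : ∀ a, f.rangeRestrict a = 0 → g.rangeRestrict a = 0 := fun a ha =>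
    Subtype.ext (h (congrArg Subtype.val ha : f a = 0))
  let e := Ideal.quotientKerAlgEquivOfSurjective f.rangeRestrict_surjective
  let π : f.range →ₐ[K] g.range :=
    (Ideal.Quotient.liftₐ (RingHom.ker f.rangeRestrict) g.rangeRestrict hlift).comp
      e.symm.toAlgHom
  have hπ (a : A) : π (f.rangeRestrict a) = g.rangeRestrict a := by
    have : e.symm (f.rangeRestrict a) = Ideal.Quotient.mk _ a := by
      rw [AlgEquiv.symm_apply_eq]; rfl
    exact congrArg (Ideal.Quotient.liftₐ (RingHom.ker f.rangeRestrict) g.rangeRestrict hlift) this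
  refine ⟨π, fun c => ?_, hπ⟩
  obtain ⟨a, rfl⟩ := g.rangeRestrict_surjective c
  exact ⟨_, hπ a⟩

theorem trdeg_range_le_of_ker_le (f : A →ₐ[K] B) (g : A →ₐ[K] C)
    (h : RingHom.ker f ≤ RingHom.ker g) :
    Algebra.trdeg K g.range ≤ Algebra.trdeg K f.range := by
  obtain ⟨π, hπ, -⟩ := exists_surjective_range_of_ker_le f g h
  exact trdeg_le_of_surjective π hπ

theorem trdeg_range_lt_of_ker_lt [IsDomain B] [IsDomain C] (f : A →ₐ[K] B) (g : A →ₐ[K] C)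
    (hfin : Algebra.trdeg K B < Cardinal.aleph0) (h : RingHom.ker f < RingHom.ker g) :
    Algebra.trdeg K g.range < Algebra.trdeg K f.range := by
  obtain ⟨π, hsurj, hπ⟩ := exists_surjective_range_of_ker_le f g h.le
  refine trdeg_lt_of_surjective_of_not_injective
    ((trdeg_le_of_injective f.range.val Subtype.val_injective).trans_lt hfin) π hsurj
    fun hinj => ?_
  obtain ⟨a, hga, hfa⟩ := Set.exists_of_ssubset (SetLike.coe_ssubset_coe.2 h)
  refine hfa (congrArg Subtype.val (hinj ?_ : f.rangeRestrict a = 0))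
  rw [hπ, map_zero]
  exact Subtype.ext hga

end Trdeg

section LeadingExponents

variable {σ : Type*}

/-- The exponent vector of a monomial, with rational coordinates. -/
def expVec (σ : Type*) : (σ →₀ ℕ) →+ (σ → ℚ) where
  toFun d i := d i
  map_zero' := by ext; simp
  map_add' _ _ := by ext; simp

@[simp]
theorem expVec_apply (d : σ →₀ ℕ) (i : σ) : expVec σ d i = d i := rfl

theorem MonomialOrder.degree_sum_of_lt {ι R : Type*} [CommSemiring R] (m : MonomialOrder σ)
    {s : Finset ι} {f : ι → MvPolynomial σ R} {j : ι} (hj : j ∈ s) (hfj : f j ≠ 0)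
    (hlt : ∀ i ∈ s, i ≠ j → m.degree (f i) ≺[m] m.degree (f j)) :
    ∑ i ∈ s, f i ≠ 0 ∧ m.degree (∑ i ∈ s, f i) = m.degree (f j) := by
  have hcoeff : (∑ i ∈ s, f i).coeff (m.degree (f j)) ≠ 0 := by
    rw [coeff_sum, Finset.sum_eq_single j (fun i hi hij => m.coeff_eq_zero_of_lt (hlt i hi hij))
      (fun h => absurd hj h)]
    exact m.coeff_degree_ne_zero_iff.2 hfj
  refine ⟨fun h => hcoeff (by rw [h, coeff_zero]), m.toSyn.injective (le_antisymm ?_ ?_)⟩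
  · refine m.degree_sum_le.trans (Finset.sup_le fun i hi => ?_)
    rcases eq_or_ne i j with rfl | hij
    · exact le_rfl
    · exact (hlt i hi hij).le
  · exact m.le_degree (mem_support_iff.2 hcoeff)

theorem algebraicIndependent_of_linearIndependent_mkQ_degree {ι R K : Type*} [CommRing R]
    [Field K] [Algebra R (MvPolynomial σ K)] (m : MonomialOrder σ)
    (hinj : Function.Injective (algebraMap R (MvPolynomial σ K))) (V : Submodule ℚ (σ → ℚ))
    (hV : ∀ r : R, expVec σ (m.degree (algebraMap R (MvPolynomial σ K) r)) ∈ V)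
    (z : ι → MvPolynomial σ K) (hz0 : ∀ i, z i ≠ 0)
    (hz : LinearIndependent ℚ fun i => V.mkQ (expVec σ (m.degree (z i)))) :
    AlgebraicIndependent R z := by
  rw [algebraicIndependent_iff]
  intro p hp
  by_contra hp0
  let t : (ι →₀ ℕ) → MvPolynomial σ K :=
    fun d => algebraMap R _ (p.coeff d) * ∏ i ∈ d.support, z i ^ d i
  have hprod0 (d : ι →₀ ℕ) : ∏ i ∈ d.support, z i ^ d i ≠ 0 :=
    Finset.prod_ne_zero_iff.2 fun i _ => pow_ne_zero _ (hz0 i)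
  have ht0 : ∀ d ∈ p.support, t d ≠ 0 := fun d hd =>
    mul_ne_zero ((map_ne_zero_iff _ hinj).2 (mem_support_iff.1 hd)) (hprod0 d)
  have hvec : ∀ d ∈ p.support, V.mkQ (expVec σ (m.degree (t d))) =
      Finsupp.linearCombination ℕ (fun i => V.mkQ (expVec σ (m.degree (z i)))) d := by
    intro d hd
    have hc := (map_ne_zero_iff _ hinj).2 (mem_support_iff.1 hd)
    rw [m.degree_mul hc (hprod0 d), m.degree_prod fun i _ => pow_ne_zero _ (hz0 i), map_add,
      map_add, (V.mkQ_apply _).trans ((Submodule.Quotient.mk_eq_zero V).2 (hV _)), zero_add,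
      Finsupp.linearCombination_apply, Finsupp.sum, map_sum, map_sum]
    refine Finset.sum_congr rfl fun i _ => ?_
    rw [m.degree_pow, map_nsmul, map_nsmul]
  have hzN : LinearIndependent ℕ fun i => V.mkQ (expVec σ (m.degree (z i))) :=
    hz.restrict_scalars' ℕ
  have hne : ∀ d ∈ p.support, ∀ e ∈ p.support, m.toSyn (m.degree (t d)) = m.toSyn (m.degree (t e)) →
      d = e := by
    intro d hd e he h
    apply hzN
    rw [← hvec d hd, ← hvec e he, m.toSyn.injective h]
  obtain ⟨d, hd, hmax⟩ := p.support.exists_max_image (fun d => m.toSyn (m.degree (t d)))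
    (support_nonempty.2 hp0)
  refine (m.degree_sum_of_lt hd (ht0 d hd) fun e he hed =>
    (hmax e he).lt_of_ne fun h => hed (hne e he d hd h)).1 ?_
  rw [← hp, aeval_def, eval₂_eq]

theorem algebraicIndependent_of_linearIndependent_degree {ι K : Type*} [Field K]
    (m : MonomialOrder σ) (z : ι → MvPolynomial σ K) (hz0 : ∀ i, z i ≠ 0)
    (hz : LinearIndependent ℚ fun i => expVec σ (m.degree (z i))) :
    AlgebraicIndependent K z := by
  refine algebraicIndependent_of_linearIndependent_mkQ_degree m (C_injective σ K) ⊥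
    (fun r => ?_) z hz0 (hz.map' _ (by simp))
  simp [algebraMap_eq]

end LeadingExponents

universe u

theorem exists_linearIndependent_degree_of_le_trdeg {K : Type u} [Field K] {k : ℕ}
    (m : MonomialOrder (Fin k)) (B : Subalgebra K (MvPolynomial (Fin k) K)) {r : ℕ}
    (hr : (r : Cardinal) ≤ Algebra.trdeg K B) :
    ∃ b : Fin r → MvPolynomial (Fin k) K, (∀ i, b i ∈ B) ∧ (∀ i, b i ≠ 0) ∧
      LinearIndependent ℚ fun i => expVec (Fin k) (m.degree (b i)) := by
  let s : Set (Fin k → ℚ) := {v | ∃ b ∈ B, b ≠ 0 ∧ expVec (Fin k) (m.degree b) = v}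
  let V := Submodule.span ℚ s
  suffices h : r ≤ Module.finrank ℚ V by
    obtain ⟨f, hfs, -, hf⟩ := Submodule.exists_fun_fin_finrank_span_eq ℚ s
    choose b hbB hb0 hb using hfs
    refine ⟨b ∘ Fin.castLE h, fun i => hbB _, fun i => hb0 _, ?_⟩
    simpa only [Function.comp_apply, hb] using! hf.comp _ (Fin.castLE_injective h)
  let e : Fin k → (Fin k → ℚ) ⧸ V := fun i => V.mkQ (Pi.single i 1)
  have hspan : Submodule.span ℚ (Set.range e) = ⊤ := by
    have : e = V.mkQ ∘ Pi.basisFun ℚ (Fin k) := by ext i; simp [e]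
    rw [this, Set.range_comp, Submodule.span_image, (Pi.basisFun ℚ (Fin k)).span_eq,
      Submodule.map_top, Submodule.range_mkQ]
  obtain ⟨T, a, ha, hTspan, hT⟩ := exists_linearIndependent' ℚ e
  have : Finite T := Finite.of_injective a ha
  have : Fintype T := Fintype.ofFinite T
  have hTcard : Fintype.card T = Module.finrank ℚ ((Fin k → ℚ) ⧸ V) :=
    (Module.finrank_eq_card_basis (Module.Basis.mk hT (by rw [hTspan, hspan]))).symm
  have hindep : AlgebraicIndependent B fun i : T => (X (a i) : MvPolynomial (Fin k) K) := by
    refine algebraicIndependent_of_linearIndependent_mkQ_degree m Subtype.val_injective V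
      (fun b => ?_) _ (fun i => X_ne_zero _) ?_
    · rcases eq_or_ne b 0 with rfl | hb
      · simp
      · exact Submodule.subset_span ⟨b, b.2, fun h => hb (Subtype.ext h), rfl⟩
    · have hTe : (fun i => V.mkQ (expVec (Fin k) (m.degree (X (a i) : MvPolynomial (Fin k) K)))) =
          e ∘ a := ?_
      · rw [hTe]
        exact hT
      funext i
      simp only [e, Function.comp_apply, m.degree_X]
      congr 1
      ext j
      simp [Finsupp.single_apply, Pi.single_apply, eq_comm]
  have h1 := trdeg_add_le (R := K) (S := B) (A := MvPolynomial (Fin k) K)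
  have h2 := hindep.lift_cardinalMk_le_trdeg
  rw [MvPolynomial.trdeg_of_isDomain] at h1
  rw [Cardinal.mk_fintype] at h2
  simp only [Cardinal.lift_natCast, Cardinal.mk_fin, Cardinal.lift_uzero] at h1 h2
  have h3 : (r : Cardinal) + Fintype.card T ≤ k := (add_le_add hr h2).trans h1
  have h4 : r + Fintype.card T ≤ k := by exact_mod_cast h3
  have h5 := V.finrank_quotient_add_finrank
  rw [Module.finrank_fin_fun] at h5
  omega

section Substitution

variable {k : ℕ}

/-- The effect on exponents of the substitution `X 0 ↦ X ^ w`, `X (i + 1) ↦ X i`. -/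
noncomputable def substExp (w : Fin k →₀ ℕ) : (Fin (k + 1) →₀ ℕ) →+ (Fin k →₀ ℕ) where
  toFun d := d.tail + d 0 • w
  map_zero' := by ext; simp [Finsupp.tail_apply]
  map_add' d e := by ext; simp [Finsupp.tail_apply]; ring

@[simp]
theorem substExp_apply (w : Fin k →₀ ℕ) (d : Fin (k + 1) →₀ ℕ) (i : Fin k) :
    substExp w d i = d i.succ + d 0 * w i := by
  simp [substExp, Finsupp.tail_apply]

/-- The monomial substitution `X 0 ↦ X ^ w`, `X (i + 1) ↦ X i`. -/
noncomputable def monomialSubst (K : Type*) [Field K] (w : Fin k →₀ ℕ) :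
    MvPolynomial (Fin (k + 1)) K →ₐ[K] MvPolynomial (Fin k) K :=
  aeval (Fin.cons (monomial w 1) X)

theorem monomialSubst_monomial {K : Type*} [Field K] (w : Fin k →₀ ℕ) (d : Fin (k + 1) →₀ ℕ)
    (c : K) : monomialSubst K w (monomial d c) = monomial (substExp w d) c := by
  rw [monomialSubst, aeval_monomial, Finsupp.prod_fintype _ _ (by simp), Fin.prod_univ_succ,
    algebraMap_eq, monomial_eq (s := substExp w d), Finsupp.prod_fintype _ _ (by simp)]
  simp only [Fin.cons_zero, Fin.cons_succ, substExp_apply, pow_add, Finset.prod_mul_distrib,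
    monomial_eq (s := w), C_1, one_mul, Finsupp.prod_fintype w _ (fun _ => pow_zero _),
    ← Finset.prod_pow, ← pow_mul]
  simp only [mul_comm]

theorem substExp_lex_lt {w : Fin (k + 1) →₀ ℕ} {d e : Fin (k + 2) →₀ ℕ} (hd : d 1 < w 0)
    (hde : d ≺[MonomialOrder.lex] e) :
    substExp w d ≺[MonomialOrder.lex] substExp w e := by
  rw [MonomialOrder.lex_lt_iff, Finsupp.Lex.lt_iff] at hde ⊢
  obtain ⟨i, hi, hlt⟩ := hde
  simp only [ofLex_toLex] at hi hlt ⊢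
  cases i using Fin.cases with
  | zero =>
    refine ⟨0, fun j hj => absurd hj (Fin.not_lt_zero j), ?_⟩
    simp only [substExp_apply, Fin.succ_zero_eq_one]
    nlinarith
  | succ i =>
    have h0 : d 0 = e 0 := hi 0 (Fin.succ_pos i)
    refine ⟨i, fun j hj => ?_, ?_⟩
    · simp [h0, hi j.succ (Fin.succ_lt_succ_iff.2 hj)]
    · simpa [h0] using hlt

theorem degree_monomialSubst {K : Type*} [Field K] {w : Fin (k + 1) →₀ ℕ}
    {p : MvPolynomial (Fin (k + 2)) K} (hp : p ≠ 0) (hw : p.totalDegree < w 0) :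
    monomialSubst K w p ≠ 0 ∧ MonomialOrder.lex.degree (monomialSubst K w p) =
      substExp w (MonomialOrder.lex.degree p) := by
  have hsum : monomialSubst K w p =
      ∑ d ∈ p.support, monomial (substExp w d) (p.coeff d) := by
    conv_lhs => rw [p.as_sum, map_sum]
    exact Finset.sum_congr rfl fun d _ => monomialSubst_monomial w d _
  have hdeg : ∀ d ∈ p.support, MonomialOrder.lex.degree
      (monomial (substExp w d) (p.coeff d)) = substExp w d := by
    classical
    intro d hd
    rw [MonomialOrder.degree_monomial, if_neg (mem_support_iff.1 hd)]
  have hmem := MonomialOrder.lex.degree_mem_support hp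
  rw [hsum, ← hdeg _ hmem]
  refine MonomialOrder.lex.degree_sum_of_lt hmem
    (by simpa using mem_support_iff.1 hmem) fun d hd hne => ?_
  rw [hdeg d hd, hdeg _ hmem]
  refine substExp_lex_lt (lt_of_le_of_lt ?_ hw) ?_
  · refine le_trans ?_ (le_totalDegree hd)
    rw [Finsupp.sum_fintype _ _ fun _ => rfl]
    exact Finset.single_le_sum (f := fun i => d i) (fun _ _ => Nat.zero_le _) (Finset.mem_univ 1)
  · exact (MonomialOrder.lex.le_degree hd).lt_of_ne
      fun h => hne (MonomialOrder.lex.toSyn.injective h)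

/-- The `ℚ`-linear extension of `substExp`. -/
def substVec (w : Fin k →₀ ℕ) : (Fin (k + 1) → ℚ) →ₗ[ℚ] (Fin k → ℚ) where
  toFun u i := u i.succ + u 0 * w i
  map_add' u v := by ext; simp; ring
  map_smul' c u := by ext; simp; ring

theorem expVec_substExp (w : Fin k →₀ ℕ) (d : Fin (k + 1) →₀ ℕ) :
    expVec (Fin k) (substExp w d) = substVec w (expVec (Fin (k + 1)) d) := by
  ext i
  simp [substVec]

theorem exists_disjoint_ker_substVec (S : Submodule ℚ (Fin (k + 2) → ℚ)) (hS : S ≠ ⊤) (N : ℕ) :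
    ∃ w : Fin (k + 1) →₀ ℕ, N ≤ w 0 ∧ Disjoint S (LinearMap.ker (substVec w)) := by
  let c (w : Fin (k + 1) →₀ ℕ) : Fin (k + 2) → ℚ := Fin.cons 1 fun i => -(w i : ℚ)
  suffices h : ∃ w : Fin (k + 1) →₀ ℕ, N ≤ w 0 ∧ c w ∉ S by
    obtain ⟨w, hN, hw⟩ := h
    refine ⟨w, hN, Submodule.disjoint_def.2 fun u hu hker => ?_⟩
    have hu_eq : u = u 0 • c w := by
      ext i
      cases i using Fin.cases with
      | zero => simp [c]
      | succ i =>
        have := congrFun (LinearMap.mem_ker.1 hker) i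
        simp only [substVec, LinearMap.coe_mk, AddHom.coe_mk, Pi.zero_apply] at this
        simp only [c, Pi.smul_apply, Fin.cons_succ, smul_eq_mul]
        linarith
    by_cases h0 : u 0 = 0
    · rw [hu_eq, h0, zero_smul]
    · exact absurd ((S.smul_mem_iff h0).1 (hu_eq ▸ hu)) hw
  by_contra! h
  refine hS (eq_top_iff.2 ?_)
  have hsucc (i : Fin (k + 1)) : (Pi.single i.succ 1 : Fin (k + 2) → ℚ) ∈ S := by
    have hmem := S.sub_mem (h (Finsupp.single 0 N) (by simp))
      (h (Finsupp.single 0 N + Finsupp.single i 1) (by simp))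
    convert hmem using 1
    ext j
    cases j using Fin.cases with
    | zero => simp [c]
    | succ j => simp [c, Pi.single_apply, Finsupp.single_apply, eq_comm]
  have hzero : (Pi.single 0 1 : Fin (k + 2) → ℚ) ∈ S := by
    have hmem := S.add_mem (h (Finsupp.single 0 N) (by simp)) (S.smul_mem (N : ℚ) (hsucc 0))
    convert hmem using 1
    ext j
    cases j using Fin.cases with
    | zero => simp [c]
    | succ j =>
      simp only [c, Pi.add_apply, Pi.smul_apply, Fin.cons_succ, Pi.single_apply, Fin.succ_inj,
        Finsupp.single_apply, eq_comm, smul_eq_mul, Fin.succ_ne_zero]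
      split_ifs <;> simp_all
  rw [← (Pi.basisFun ℚ (Fin (k + 2))).span_eq, Submodule.span_le]
  rintro _ ⟨i, rfl⟩
  cases i using Fin.cases with
  | zero => simpa using hzero
  | succ i => simpa using hsucc i

end Substitution

section Specialization

variable {K A : Type u} [Field K] [CommRing A] [Algebra K A]

theorem exists_algHom_le_trdeg_range_comp_of_succ {k r : ℕ} (hrk : r ≤ k)
    (f : A →ₐ[K] MvPolynomial (Fin (k + 1)) K) (hr : (r : Cardinal) ≤ Algebra.trdeg K f.range) :
    ∃ θ : MvPolynomial (Fin (k + 1)) K →ₐ[K] MvPolynomial (Fin k) K,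
      (r : Cardinal) ≤ Algebra.trdeg K (θ.comp f).range := by
  obtain _ | k := k
  · obtain rfl : r = 0 := by omega
    exact ⟨aeval 0, by simp⟩
  obtain ⟨b, hbf, hb0, hb⟩ := exists_linearIndependent_degree_of_le_trdeg MonomialOrder.lex _ hr
  have hS : Submodule.span ℚ (Set.range fun i => expVec _ (MonomialOrder.lex.degree (b i))) ≠ ⊤ := by
    intro h
    have := finrank_span_eq_card hb
    rw [h, finrank_top, Module.finrank_fin_fun, Fintype.card_fin] at this
    omega
  obtain ⟨w, hw, hdisj⟩ := exists_disjoint_ker_substVec _ hS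
    (Finset.univ.sup (fun i => (b i).totalDegree) + 1)
  have hdeg (i : Fin r) := degree_monomialSubst (hb0 i) (w := w) <| Nat.lt_of_lt_of_le
    (Nat.lt_succ_of_le (Finset.le_sup (f := fun i => (b i).totalDegree) (Finset.mem_univ i))) hw
  refine ⟨monomialSubst K w, ?_⟩
  have hind := algebraicIndependent_of_linearIndependent_degree MonomialOrder.lex
    (fun i => monomialSubst K w (b i)) (fun i => (hdeg i).1) (by
      simp only [(hdeg _).2, expVec_substExp]
      exact hb.map hdisj)
  choose a ha using hbf
  have hind' : AlgebraicIndependent K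
      fun i => ((monomialSubst K w).comp f).rangeRestrict (a i) := by
    refine AlgebraicIndependent.of_comp ((monomialSubst K w).comp f).range.val ?_
    convert hind using 2 with i
    simp [← ha i]
  simpa using hind'.lift_cardinalMk_le_trdeg

theorem exists_algHom_le_trdeg_range_comp {n r : ℕ} (hrn : r ≤ n)
    (f : A →ₐ[K] MvPolynomial (Fin n) K) (hr : (r : Cardinal) ≤ Algebra.trdeg K f.range) :
    ∃ θ : MvPolynomial (Fin n) K →ₐ[K] MvPolynomial (Fin r) K,
      (r : Cardinal) ≤ Algebra.trdeg K (θ.comp f).range := by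
  induction n, hrn using Nat.le_induction with
  | base => exact ⟨AlgHom.id K _, hr⟩
  | succ n hrn ih =>
    obtain ⟨θ, hθ⟩ := exists_algHom_le_trdeg_range_comp_of_succ hrn f hr
    obtain ⟨η, hη⟩ := ih (θ.comp f) hθ
    exact ⟨η.comp θ, hη⟩

theorem trdeg_range_le {n : ℕ} (f : A →ₐ[K] MvPolynomial (Fin n) K) :
    Algebra.trdeg K f.range ≤ n := by
  simpa [MvPolynomial.trdeg_of_isDomain] using
    trdeg_le_of_injective f.range.val Subtype.val_injective

theorem exists_ker_lt_and_le_trdeg_range {n r : ℕ} (f : A →ₐ[K] MvPolynomial (Fin n) K)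
    (hr : ((r + 1 : ℕ) : Cardinal) ≤ Algebra.trdeg K f.range) :
    ∃ g : A →ₐ[K] MvPolynomial (Fin n) K,
      RingHom.ker f < RingHom.ker g ∧ (r : Cardinal) ≤ Algebra.trdeg K g.range := by
  have hrn : r + 1 ≤ n := by exact_mod_cast hr.trans (trdeg_range_le f)
  have hrf : (r : Cardinal) < Algebra.trdeg K f.range :=
    (Nat.cast_lt.2 r.lt_succ_self).trans_le hr
  obtain ⟨θ, hθ⟩ := exists_algHom_le_trdeg_range_comp (Nat.le_of_succ_le hrn) f hrf.le
  let ι : MvPolynomial (Fin r) K →ₐ[K] MvPolynomial (Fin n) K :=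
    rename (Fin.castLE (Nat.le_of_succ_le hrn))
  have hι : Function.Injective ι := rename_injective _ (Fin.castLE_injective _)
  have hker : RingHom.ker (θ.comp f) = RingHom.ker (ι.comp (θ.comp f)) := by
    ext a
    exact (map_eq_zero_iff ι hι).symm
  have htrdeg : Algebra.trdeg K (ι.comp (θ.comp f)).range = Algebra.trdeg K (θ.comp f).range := by
    rw [AlgHom.range_comp]
    exact ((θ.comp f).range.equivMapOfInjective ι hι).trdeg_eq.symm
  refine ⟨ι.comp (θ.comp f), ?_, hθ.trans_eq htrdeg.symm⟩
  rw [← hker]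
  refine lt_of_le_of_ne (fun a (ha : f a = 0) => ?_) fun h => ?_
  · change θ (f a) = 0
    rw [ha, map_zero]
  · exact hrf.not_ge ((trdeg_range_le_of_ker_le (θ.comp f) f h.ge).trans (trdeg_range_le _))

theorem exists_ker_chain_iff {n : ℕ} (f : A →ₐ[K] MvPolynomial (Fin n) K) (r : ℕ) :
    (∃ ψ : Fin (r + 1) → (A →ₐ[K] MvPolynomial (Fin n) K),
      ψ 0 = f ∧ ∀ i : Fin r, RingHom.ker (ψ i.castSucc) < RingHom.ker (ψ i.succ)) ↔
      (r : Cardinal) ≤ Algebra.trdeg K f.range := by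
  induction r generalizing f with
  | zero => simpa using ⟨fun _ => f, rfl⟩
  | succ r ih =>
    constructor
    · rintro ⟨ψ, rfl, hψ⟩
      have h1 := (ih (ψ 1)).1 ⟨fun i => ψ i.succ, rfl, fun i => hψ i.succ⟩
      have h2 := trdeg_range_lt_of_ker_lt (ψ 0) (ψ 1)
        (by simp [MvPolynomial.trdeg_of_isDomain]) (hψ 0)
      rw [Nat.cast_succ, ← Cardinal.succ_natCast]
      exact Order.succ_le_of_lt (h1.trans_lt h2)
    · intro h
      obtain ⟨g, hfg, hg⟩ := exists_ker_lt_and_le_trdeg_range f h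
      obtain ⟨ψ, rfl, hψ⟩ := (ih g).2 hg
      refine ⟨Fin.cons f ψ, rfl, fun i => ?_⟩
      cases i using Fin.cases with
      | zero => exact hfg
      | succ i => exact hψ i

end Specialization

/-- The 'external' rank (transcendence degree of the image) equals the 'internal' rank
(maximal length of a strictly increasing chain of kernels starting at `ker φ`). -/
theorem stmt_3 (K : Type) [Field K] (n : ℕ)
    (φ : MvPolynomial (Fin n) K →ₐ[K] MvPolynomial (Fin n) K) (m : ℕ) :
    algTrdeg K ↥φ.range = (m : Cardinal) ↔
      ((∃ ψ : Fin (m + 1) → (MvPolynomial (Fin n) K →ₐ[K] MvPolynomial (Fin n) K),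
          ψ 0 = φ ∧ ∀ i : Fin m, RingHom.ker (ψ i.castSucc) < RingHom.ker (ψ i.succ)) ∧
       ¬ (∃ ψ : Fin (m + 2) → (MvPolynomial (Fin n) K →ₐ[K] MvPolynomial (Fin n) K),
          ψ 0 = φ ∧ ∀ i : Fin (m + 1), RingHom.ker (ψ i.castSucc) < RingHom.ker (ψ i.succ))) := by
  rw [exists_ker_chain_iff φ m, exists_ker_chain_iff φ (m + 1), algTrdeg_eq_trdeg]
  obtain ⟨t, ht⟩ := Cardinal.lt_aleph0.1 ((trdeg_range_le φ).trans_lt Cardinal.natCast_lt_aleph0)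
  rw [ht, Nat.cast_inj, Nat.cast_le, Nat.cast_le]
  omega
end

section
/- Let K be a field, A = K[x₁,…,xₙ], and φ a K-algebra endomorphism of A with trdeg_K(image φ) = m, where m ≥ 1. Then there exists a K-algebra endomorphism φ' of A such that ker φ ⊊ ker φ' (strict inclusion of kernels) and trdeg_K(image φ') = m − 1. -/
open MvPolynomial

/-- An algebraic element stays algebraic under every specialization that does not kill a certain
nonzero element of the base. -/
theorem IsAlgebraic.exists_ne_zero_forall_isAlgebraic_map {D R : Type*} [CommRing D] [CommRing R]
    [Algebra D R] {x : R} (hx : IsAlgebraic D x) :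
    ∃ a : D, a ≠ 0 ∧ ∀ {D' R' : Type} [CommRing D'] [CommRing R'] [Algebra D' R']
      (f : D →+* D') (g : R →+* R'),
      (algebraMap D' R').comp f = g.comp (algebraMap D R) → f a ≠ 0 → IsAlgebraic D' (g x) := by
  obtain ⟨p, hp, hpx⟩ := hx
  refine ⟨p.leadingCoeff, Polynomial.leadingCoeff_ne_zero.mpr hp, ?_⟩
  intro D' R' _ _ _ f g h ha
  refine ⟨p.map f, fun h0 ↦ ha ?_, ?_⟩
  · simpa using congrArg (Polynomial.coeff · p.natDegree) h0
  · rw [Polynomial.aeval_def, Polynomial.eval₂_map, h, ← Polynomial.hom_eval₂,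
      ← Polynomial.aeval_def, hpx, map_zero]

/-- A generic specialization of a polynomial ring decreases the transcendence degree of a
subalgebra by at most as much as it decreases that of the whole ring. -/
theorem MvPolynomial.exists_ne_zero_forall_trdeg_map {K ι : Type} [Field K] [Finite ι]
    (S : Subalgebra K (MvPolynomial ι K)) :
    ∃ a : MvPolynomial ι K, a ≠ 0 ∧ ∀ {R' : Type} [CommRing R'] [IsDomain R'] [Algebra K R']
      (σ : MvPolynomial ι K →ₐ[K] R'), Function.Surjective σ → σ a ≠ 0 →
      Algebra.trdeg K R' + Algebra.trdeg K S ≤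
        Algebra.trdeg K (S.map σ) + Algebra.trdeg K (MvPolynomial ι K) := by
  have := Fintype.ofFinite ι
  obtain ⟨t, ht⟩ := exists_isTranscendenceBasis S (MvPolynomial ι K)
  have halg : Algebra.IsAlgebraic (Algebra.adjoin S t) (MvPolynomial ι K) := by
    have h := ht.isAlgebraic
    rwa [Subtype.range_coe] at h
  choose a ha0 ha using fun i : ι ↦
    (halg.isAlgebraic (X i : MvPolynomial ι K)).exists_ne_zero_forall_isAlgebraic_map
  refine ⟨∏ i, (a i : MvPolynomial ι K), Finset.prod_ne_zero_iff.mpr fun i _ ↦ by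
    simpa using ha0 i, ?_⟩
  intro R' _ _ _ σ hσ hσa
  have hmem (d : MvPolynomial ι K) (hd : d ∈ Algebra.adjoin S t) :
      σ d ∈ Algebra.adjoin (S.map σ) (σ '' t) := by
    induction hd using Algebra.adjoin_induction with
    | mem x hx => exact Algebra.subset_adjoin ⟨x, hx, rfl⟩
    | algebraMap r =>
      exact Subalgebra.algebraMap_mem _ (⟨σ r, r, r.2, rfl⟩ : S.map σ)
    | add x y _ _ hx hy => rw [map_add]; exact add_mem hx hy
    | mul x y _ _ hx hy => rw [map_mul]; exact mul_mem hx hy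
  let f : Algebra.adjoin S t →+* Algebra.adjoin (S.map σ) (σ '' t) :=
    RingHom.codRestrict ((σ : MvPolynomial ι K →+* R').comp (algebraMap _ _)) _
      fun d ↦ hmem d d.2
  have halg' : Algebra.IsAlgebraic (Algebra.adjoin (S.map σ) (σ '' t)) R' := by
    refine ⟨fun y ↦ ?_⟩
    obtain ⟨p, rfl⟩ := hσ y
    induction p using MvPolynomial.induction_on with
    | C c =>
      have : σ (C c) = algebraMap (Algebra.adjoin (S.map σ) (σ '' t)) R'
          (algebraMap K _ c) := by
        rw [← MvPolynomial.algebraMap_eq, AlgHom.commutes]; rfl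
      rw [this]
      exact isAlgebraic_algebraMap _
    | add p q hp hq => rw [map_add]; exact hp.add hq
    | mul_X p i hp =>
      rw [map_mul]
      refine hp.mul (ha i f (σ : MvPolynomial ι K →+* R') rfl fun h0 ↦ hσa ?_)
      rw [map_prod]
      exact Finset.prod_eq_zero (Finset.mem_univ i) (congrArg Subtype.val h0)
  have hle : Algebra.trdeg (S.map σ) R' ≤ Algebra.trdeg S (MvPolynomial ι K) :=
    calc Algebra.trdeg (S.map σ) R' ≤ Cardinal.mk (σ '' t) :=
          Algebra.IsAlgebraic.trdeg_le_cardinalMk _ _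
      _ ≤ Cardinal.mk t := Cardinal.mk_image_le
      _ = _ := ht.cardinalMk_eq_trdeg
  rw [← trdeg_add_eq K S (A := MvPolynomial ι K), ← trdeg_add_eq K (S.map σ) (A := R'),
    add_assoc, add_comm (Algebra.trdeg K S)]
  gcongr

/-- Substituting a suitable polynomial in the other variables for one variable decreases the
transcendence degree of a subalgebra by at most one. -/
theorem MvPolynomial.exists_algHom_trdeg_le_trdeg_map_add_one {K : Type} [Field K] {k : ℕ}
    (hk : k ≠ 0) (S : Subalgebra K (MvPolynomial (Fin (k + 1)) K)) :
    ∃ σ : MvPolynomial (Fin (k + 1)) K →ₐ[K] MvPolynomial (Fin k) K,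
      Algebra.trdeg K S ≤ Algebra.trdeg K (S.map σ) + 1 := by
  obtain ⟨a, ha0, ha⟩ := exists_ne_zero_forall_trdeg_map S
  have : NeZero k := ⟨hk⟩
  have : Infinite (MvPolynomial (Fin k) K) := inferInstance
  obtain ⟨c, hc⟩ : ∃ c, (finSuccEquiv K k a).eval c ≠ 0 := by
    by_contra! h
    exact ha0 ((finSuccEquiv K k).map_eq_zero_iff.mp (Polynomial.funext fun c ↦ by simp [h c]))
  let σ := ((Polynomial.aeval (R := MvPolynomial (Fin k) K) c).restrictScalars K).comp
    (finSuccEquiv K k).toAlgHom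
  have hσ : Function.Surjective σ := fun p ↦
    ⟨(finSuccEquiv K k).symm (Polynomial.C p), by simp [σ]⟩
  have h := ha σ hσ (by simpa [σ, Polynomial.aeval_def] using hc)
  refine ⟨σ, ?_⟩
  simp only [MvPolynomial.trdeg_of_isDomain, Cardinal.mk_fin, Cardinal.lift_natCast] at h
  rw [add_comm, Nat.cast_add, Nat.cast_one, add_comm (k : Cardinal), ← add_assoc] at h
  exact (Cardinal.add_le_add_iff_of_lt_aleph0 (Cardinal.natCast_lt_aleph0)).mp h

/-- A homomorphism to a polynomial ring can be specialized to one of any smaller rank. -/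
theorem MvPolynomial.exists_algHom_trdeg_range_eq {K A : Type} [Field K] [CommRing A]
    [Algebra K A] (r k : ℕ) (φ : A →ₐ[K] MvPolynomial (Fin k) K)
    (h : (r : Cardinal) ≤ Algebra.trdeg K φ.range) :
    ∃ l ≤ k, ∃ ψ : A →ₐ[K] MvPolynomial (Fin l) K,
      RingHom.ker φ ≤ RingHom.ker ψ ∧ Algebra.trdeg K ψ.range = r := by
  induction k with
  | zero =>
    refine ⟨0, le_rfl, φ, le_rfl, h.antisymm' ?_⟩
    refine (trdeg_le_of_injective φ.range.val Subtype.val_injective).trans ?_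
    simp [MvPolynomial.trdeg_of_isDomain]
  | succ k ih =>
    rcases h.eq_or_lt with h | h
    · exact ⟨k + 1, le_rfl, φ, le_rfl, h.symm⟩
    obtain ⟨σ, hσ⟩ : ∃ σ : MvPolynomial (Fin (k + 1)) K →ₐ[K] MvPolynomial (Fin k) K,
        (r : Cardinal) ≤ Algebra.trdeg K (σ.comp φ).range := by
      have h' := Order.succ_le_of_lt h
      rw [Cardinal.succ_natCast] at h'
      rcases eq_or_ne k 0 with rfl | hk
      · refine ⟨aeval 0, ?_⟩
        have h1 := h'.trans
          (trdeg_le_of_injective φ.range.val Subtype.val_injective)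
        simp only [MvPolynomial.trdeg_of_isDomain, Cardinal.mk_fin, Cardinal.lift_natCast] at h1
        norm_cast at h1
        obtain rfl : r = 0 := by omega
        simp
      · obtain ⟨σ, hσ⟩ := exists_algHom_trdeg_le_trdeg_map_add_one hk φ.range
        refine ⟨σ, ?_⟩
        rw [AlgHom.range_comp]
        have h2 := h'.trans hσ
        exact (Cardinal.add_le_add_iff_of_lt_aleph0 Cardinal.one_lt_aleph0).mp h2
    obtain ⟨l, hl, ψ, hker, hψ⟩ := ih (σ.comp φ) hσ
    refine ⟨l, hl.trans k.le_succ, ψ, le_trans (fun x hx ↦ ?_) hker, hψ⟩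
    rw [RingHom.mem_ker] at hx ⊢
    rw [AlgHom.comp_apply, hx, map_zero]

/-- The rank of an algebra homomorphism is determined by its kernel. -/
theorem AlgHom.trdeg_range_eq_of_ker_eq {K A B C : Type} [Field K] [CommRing A] [CommRing B]
    [CommRing C] [Algebra K A] [Algebra K B] [Algebra K C] (f : A →ₐ[K] B) (g : A →ₐ[K] C)
    (h : RingHom.ker f = RingHom.ker g) :
    Algebra.trdeg K f.range = Algebra.trdeg K g.range :=
  ((Ideal.quotientKerEquivRange f).symm.trans
    ((Ideal.quotientEquivAlgOfEq K h).trans (Ideal.quotientKerEquivRange g))).trdeg_eq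

/-- For an endomorphism `φ` of rank `m ≥ 1` there is an endomorphism `φ'` with
`ker φ ⊊ ker φ'` and rank `m - 1`. -/
theorem stmt_5 (K : Type) [Field K] (n : ℕ) (m : ℕ) (hm : 1 ≤ m)
    (φ : MvPolynomial (Fin n) K →ₐ[K] MvPolynomial (Fin n) K)
    (hφ : algTrdeg K ↥φ.range = (m : Cardinal)) :
    ∃ φ' : MvPolynomial (Fin n) K →ₐ[K] MvPolynomial (Fin n) K,
      RingHom.ker φ < RingHom.ker φ' ∧
      algTrdeg K ↥φ'.range = ((m - 1 : ℕ) : Cardinal) := by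
  change Algebra.trdeg K φ.range = m at hφ
  obtain ⟨l, hl, ψ, hker, hψ⟩ := exists_algHom_trdeg_range_eq (m - 1) n φ
    (by rw [hφ]; exact_mod_cast m.sub_le 1)
  let φ' := (rename (R := K) (Fin.castLE hl)).comp ψ
  have hker' : RingHom.ker φ' = RingHom.ker ψ := by
    ext x
    simp only [RingHom.mem_ker, φ', AlgHom.comp_apply]
    exact map_eq_zero_iff _ (rename_injective _ (Fin.castLE_injective hl))
  have hrank : Algebra.trdeg K φ'.range = ((m - 1 : ℕ) : Cardinal) :=
    (φ'.trdeg_range_eq_of_ker_eq ψ hker').trans hψ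
  refine ⟨φ', lt_of_le_of_ne (hker.trans hker'.ge) fun h ↦ ?_, hrank⟩
  have h1 := φ.trdeg_range_eq_of_ker_eq φ' h
  rw [hφ, hrank, Nat.cast_inj] at h1
  omega
end

section
/- Let K be a field and R a subalgebra of the polynomial algebra K[x₁,…,xₙ] with transcendence degree m over K (so m ≤ n). Then there exists an injective K-algebra homomorphism from R into the polynomial algebra K[x₁,…,x_m] in m variables. -/
open MvPolynomial

theorem Polynomial.eval₂_expand_X_ne_zero {D : Type*} [CommRing D] {P : Polynomial (Polynomial D)}
    (hP : P ≠ 0) {N : ℕ} (hN : P.natDegree < N) :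
    P.eval₂ (Polynomial.expand D N).toRingHom Polynomial.X ≠ 0 := by
  intro h
  have hc := congrArg
    (fun q => q.coeff (P.leadingCoeff.natDegree * N + P.natDegree)) h
  simp only [Polynomial.eval₂_eq_sum_range, Polynomial.finsetSum_coeff, Polynomial.coeff_zero,
    AlgHom.toRingHom_eq_coe, RingHom.coe_coe, Polynomial.coeff_mul_X_pow'] at hc
  rw [Finset.sum_eq_single_of_mem P.natDegree (by simp)] at hc
  · rw [if_pos (by omega), Nat.add_sub_cancel, Polynomial.coeff_expand_mul (by omega)] at hc
    exact hP (by simpa using hc)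
  · intro b hb hne
    rw [Finset.mem_range] at hb
    rw [if_pos (by omega), Polynomial.coeff_expand (by omega), if_neg]
    rw [Nat.add_sub_assoc (by omega), Nat.dvd_add_right (Dvd.intro_left _ rfl)]
    intro hd
    exact absurd (Nat.le_of_dvd (by omega) hd) (by omega)

theorem IsAlgebraic.of_eval₂_aeval_pow {D B : Type*} [CommRing D] [CommRing B] [Algebra D B]
    {P : Polynomial (Polynomial D)} (hP : P ≠ 0) {N : ℕ} (hN : P.natDegree < N) {t : B}
    (h : P.eval₂ (Polynomial.aeval (R := D) (t ^ N)).toRingHom t = 0) : IsAlgebraic D t := by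
  refine ⟨_, Polynomial.eval₂_expand_X_ne_zero hP hN, ?_⟩
  rw [← h, ← AlgHom.coe_toRingHom, Polynomial.hom_eval₂]
  congr 1
  · ext <;> simp
  · simp

theorem IsAlgebraic.of_eval₂_aeval {D B : Type*} [CommRing D] [IsDomain D] [CommRing B] [IsDomain B]
    [Algebra D B] {g b : B} (hg : IsAlgebraic D g) {P : Polynomial (Polynomial D)}
    (hP : P.map (Polynomial.aeval (R := D) g).toRingHom ≠ 0)
    (h : P.eval₂ (Polynomial.aeval (R := D) g).toRingHom b = 0) : IsAlgebraic D b := by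
  let E := Subalgebra.algebraicClosure D B
  let g' : E := ⟨g, hg⟩
  have hcomp : (algebraMap E B).comp (Polynomial.aeval (R := D) g').toRingHom =
      (Polynomial.aeval (R := D) g).toRingHom := by
    ext
    · simp
    · simp [g']
  have : IsAlgebraic E b := by
    refine ⟨P.map (Polynomial.aeval (R := D) g').toRingHom, fun h0 => hP ?_, ?_⟩
    · rw [← hcomp, ← Polynomial.map_map, h0, Polynomial.map_zero]
    · rw [Polynomial.aeval_def, Polynomial.eval₂_map, hcomp, h]
  exact this.restrictScalars D

theorem IsTranscendenceBasis.exists_eval₂_eq_zero {K ι A : Type*} [Field K] [CommRing A]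
    [IsDomain A] [Algebra K A] {z : Option ι → A} (hz : IsTranscendenceBasis K z) (a : A) :
    ∃ P : Polynomial (Polynomial (MvPolynomial ι K)),
      P.map ((aeval z).comp (optionEquivLeft K ι).symm.toAlgHom).toRingHom ≠ 0 ∧
      P.eval₂ ((aeval z).comp (optionEquivLeft K ι).symm.toAlgHom).toRingHom a = 0 := by
  have := hz.isAlgebraic
  obtain ⟨p, hp, hpa⟩ :=
    Algebra.IsAlgebraic.isAlgebraic (R := Algebra.adjoin K (Set.range z)) a
  let e := hz.1.aevalEquiv.symm.trans (optionEquivLeft K ι)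
  have he : ((aeval z).comp (optionEquivLeft K ι).symm.toAlgHom).toRingHom.comp e.toRingHom =
      algebraMap (Algebra.adjoin K (Set.range z)) A := by
    ext x
    obtain ⟨q, rfl⟩ := hz.1.aevalEquiv.surjective x
    simp [e, hz.1.algebraMap_aevalEquiv]
  refine ⟨p.map e.toRingHom, ?_, ?_⟩
  · rw [Polynomial.map_map, he,
      ← Polynomial.map_zero (algebraMap (Algebra.adjoin K (Set.range z)) A)]
    exact (Polynomial.map_injective _ Subtype.val_injective).ne hp
  · rw [Polynomial.eval₂_map, he]
    exact hpa

theorem Polynomial.eventually_eval_pow_ne_zero {B : Type*} [CommRing B] [IsDomain B]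
    {p : Polynomial B} (hp : p ≠ 0) {t : B} (ht : Function.Injective (t ^ · : ℕ → B)) :
    ∀ᶠ N in Filter.atTop, p.eval (t ^ N) ≠ 0 := by
  rw [← Nat.cofinite_eq_atTop]
  exact ht.tendsto_cofinite.eventually
    (Polynomial.finite_setOfPred_isRoot hp).eventually_cofinite_notMem

theorem MvPolynomial.exists_isTranscendenceBasis_eval {K ι τ : Type*} [Field K] [Finite τ]
    [Nonempty τ] {z : Option ι → Polynomial (MvPolynomial τ K)} (hz : IsTranscendenceBasis K z)
    (hX : z none = Polynomial.X) :
    ∃ g : MvPolynomial τ K, IsTranscendenceBasis K fun i => (z (some i)).eval g := by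
  obtain ⟨l⟩ := ‹Nonempty τ›
  choose P hP hPe using fun i : τ => hz.exists_eval₂_eq_zero (Polynomial.C (X i))
  have hinj : Function.Injective ((X l : MvPolynomial τ K) ^ · : ℕ → MvPolynomial τ K) := by
    intro a b h
    simpa using congrArg totalDegree h
  obtain ⟨N, hN, hNl⟩ := ((Filter.eventually_all.2 fun i =>
    Polynomial.eventually_eval_pow_ne_zero (Polynomial.leadingCoeff_ne_zero.2 (hP i)) hinj).and
    (Filter.eventually_gt_atTop (P l).natDegree)).exists
  set g : MvPolynomial τ K := X l ^ N
  refine ⟨g, ?_⟩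
  set y : ι → MvPolynomial τ K := fun i => (z (some i)).eval g with hy
  let D := Algebra.adjoin K (Set.range y)
  let f : MvPolynomial ι K →ₐ[K] D := aeval fun i => ⟨y i, Algebra.subset_adjoin ⟨i, rfl⟩⟩
  have hcomp : (Polynomial.evalRingHom g).comp
      ((aeval z).comp (optionEquivLeft K ι).symm.toAlgHom).toRingHom =
      (Polynomial.aeval (R := D) g).toRingHom.comp (Polynomial.mapRingHom f.toRingHom) := by
    ext
    · simp [Polynomial.algebraMap_apply]
    · simp [f, hy]
    · simp [hX]
  let Q : τ → Polynomial (Polynomial D) := fun i => (P i).map (Polynomial.mapRingHom f.toRingHom)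
  have hQ (i : τ) : (Q i).map (Polynomial.aeval (R := D) g).toRingHom ≠ 0 := by
    rw [Polynomial.map_map, ← hcomp, ← Polynomial.map_map]
    intro h
    apply hN i
    rw [← Polynomial.coe_evalRingHom, Polynomial.leadingCoeff, ← Polynomial.coeff_map, h,
      Polynomial.coeff_zero]
  have hQe (i : τ) : (Q i).eval₂ (Polynomial.aeval (R := D) g).toRingHom (X i) = 0 := by
    have := congrArg (Polynomial.evalRingHom g) (hPe i)
    rw [Polynomial.hom_eval₂, hcomp, map_zero] at this
    rw [Polynomial.eval₂_map]
    simpa using this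
  have hl : IsAlgebraic D (X l : MvPolynomial τ K) :=
    .of_eval₂_aeval_pow (P := Q l) (fun h => hQ l (by rw [h, Polynomial.map_zero]))
      (Polynomial.natDegree_map_le.trans_lt hNl) (hQe l)
  have hi (i : τ) : IsAlgebraic D (X i : MvPolynomial τ K) :=
    .of_eval₂_aeval (hl.pow N) (hQ i) (hQe i)
  have halg : Algebra.IsAlgebraic D (MvPolynomial τ K) := by
    refine ⟨fun p => ?_⟩
    induction p using MvPolynomial.induction_on with
    | C a => exact isAlgebraic_algebraMap (algebraMap K D a)
    | add p q hp hq => exact hp.add hq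
    | mul_X p i hp => exact hp.mul (hi i)
  have hcard := hz.lift_cardinalMk_eq ((optionEquivLeft K τ).isTranscendenceBasis
    (IsTranscendenceBasis.mvPolynomial (Option τ) K))
  obtain ⟨e⟩ := Cardinal.lift_mk_eq'.1 hcard
  have e' := Equiv.removeNone e
  have := Finite.of_equiv τ e'.symm
  refine Algebra.IsAlgebraic.isTranscendenceBasis_of_lift_le_trdeg_of_finite K y ?_
  rw [trdeg_of_isDomain, ← Nat.cast_card (α := ι), ← Nat.cast_card (α := τ)]
  simp [Nat.card_congr e']

theorem MvPolynomial.exists_algHom_fin_of_card_lt {K ι : Type*} [Field K] [Finite ι] [Nonempty ι]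
    {n : ℕ} {y : ι → MvPolynomial (Fin (n + 1)) K} (hcard : Nat.card ι < n + 1)
    (hy : AlgebraicIndependent K y) :
    ∃ φ : MvPolynomial (Fin (n + 1)) K →ₐ[K] MvPolynomial (Fin n) K,
      AlgebraicIndependent K (φ ∘ y) := by
  have htop : Algebra.adjoin K (Set.range y ∪ Set.range (X : Fin (n + 1) → MvPolynomial _ K)) = ⊤ :=
    top_le_iff.1 (adjoin_range_X.ge.trans (Algebra.adjoin_mono Set.subset_union_right))
  have halg : Algebra.IsAlgebraic (Algebra.adjoin K (Set.range y ∪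
      Set.range (X : Fin (n + 1) → MvPolynomial _ K))) (MvPolynomial (Fin (n + 1)) K) := by
    rw [htop]
    exact ⟨fun p => isAlgebraic_algebraMap (⟨p, trivial⟩ : (⊤ : Subalgebra K _))⟩
  obtain ⟨u, hyu, hut, hu⟩ := exists_isTranscendenceBasis_between (R := K)
    (Set.range y) (Set.range y ∪ Set.range X) Set.subset_union_left hy.coe_range
  have hucard : Nat.card u = n + 1 := by
    have h := hu.lift_cardinalMk_eq (IsTranscendenceBasis.mvPolynomial (Fin (n + 1)) K)
    obtain ⟨e⟩ := Cardinal.lift_mk_eq'.1 h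
    simpa using Nat.card_congr e
  obtain ⟨j, hju, hjy⟩ : ∃ j, X j ∈ u ∧ X j ∉ Set.range y := by
    by_contra! h
    have huy : u = Set.range y := by
      refine Set.Subset.antisymm (fun p hp => ?_) hyu
      rcases hut hp with hp' | ⟨j, rfl⟩
      exacts [hp', h j hp]
    rw [huy, Nat.card_congr (Equiv.ofInjective y hy.injective).symm] at hucard
    omega
  classical
  let a : u := ⟨X j, hju⟩
  let e : MvPolynomial (Fin (n + 1)) K ≃ₐ[K] Polynomial (MvPolynomial (Fin n) K) :=
    (renameEquiv K (finSuccEquiv' j)).trans (optionEquivLeft K (Fin n))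
  have : NeZero n := ⟨by have : 0 < Nat.card ι := Nat.card_pos; omega⟩
  obtain ⟨g, hg⟩ := exists_isTranscendenceBasis_eval
    (e.isTranscendenceBasis ((isTranscendenceBasis_equiv (Equiv.optionSubtypeNe a)).2 hu))
    (by simp [e, a])
  refine ⟨((Polynomial.aeval g).restrictScalars K).comp e.toAlgHom, ?_⟩
  let i : ι → {b : u // b ≠ a} := fun i =>
    ⟨⟨y i, hyu ⟨i, rfl⟩⟩, fun h => hjy ⟨i, congrArg Subtype.val h⟩⟩
  have hi : Function.Injective i := fun b c h =>
    hy.injective (congrArg (fun x => x.1.1) h)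
  convert hg.1.comp i hi using 1
  ext1 b
  simp [i]

theorem MvPolynomial.exists_algHom_algebraicIndependent {K ι : Type*} [Field K] [Finite ι] {n : ℕ}
    {y : ι → MvPolynomial (Fin n) K} (hy : AlgebraicIndependent K y) :
    ∃ φ : MvPolynomial (Fin n) K →ₐ[K] MvPolynomial ι K, AlgebraicIndependent K (φ ∘ y) := by
  obtain _ | _ := isEmpty_or_nonempty ι
  · exact ⟨aeval 0, algebraicIndependent_empty_type⟩
  have card_le {n : ℕ} {y : ι → MvPolynomial (Fin n) K} (hy : AlgebraicIndependent K y) :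
      Nat.card ι ≤ n := by
    have h := hy.lift_cardinalMk_le_trdeg
    rw [trdeg_of_isDomain, ← Nat.cast_card (α := ι)] at h
    simpa using h
  obtain ⟨k, rfl⟩ := Nat.exists_eq_add_of_le (card_le hy)
  induction k with
  | zero =>
    let e : Fin (Nat.card ι) ≃ ι := (Finite.equivFin ι).symm
    exact ⟨rename e, hy.map' (rename_injective e e.injective)⟩
  | succ k ih =>
    obtain ⟨φ, hφ⟩ := exists_algHom_fin_of_card_lt (Nat.lt_succ_of_le (Nat.le_add_right _ k)) hy
    obtain ⟨ψ, hψ⟩ := ih hφ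
    exact ⟨ψ.comp φ, hψ⟩

theorem AlgHom.injective_of_algebraicIndependent_comp {K ι A B : Type*} [Field K] [CommRing A]
    [IsDomain A] [CommRing B] [Algebra K A] [Algebra K B] {x : ι → A}
    (hx : IsTranscendenceBasis K x) (f : A →ₐ[K] B) (hf : AlgebraicIndependent K (f ∘ x)) :
    Function.Injective f := by
  have := hx.isAlgebraic
  refine (injective_iff_map_eq_zero f).2 fun a ha => of_not_not fun ha0 => ?_
  refine Ideal.comap_ne_bot_of_algebraic_mem (I := RingHom.ker f) ha0 ha
    (Algebra.IsAlgebraic.isAlgebraic (R := Algebra.adjoin K (Set.range x)) a) ?_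
  rw [eq_bot_iff]
  intro c hc
  obtain ⟨q, rfl⟩ := hx.1.aevalEquiv.surjective c
  rw [Ideal.mem_comap, hx.1.algebraMap_aevalEquiv, RingHom.mem_ker,
    ← AlgHom.comp_apply, comp_aeval] at hc
  simpa using hf.eq_zero_of_aeval_eq_zero q hc

/-- A subalgebra of `K[x₁,…,xₙ]` of transcendence degree `m` embeds into `K[x₁,…,x_m]`. -/
theorem stmt_6 (K : Type) [Field K] (n m : ℕ)
    (R : Subalgebra K (MvPolynomial (Fin n) K))
    (hR : algTrdeg K ↥R = (m : Cardinal)) :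
    ∃ f : ↥R →ₐ[K] MvPolynomial (Fin m) K, Function.Injective f := by
  obtain ⟨s, hs⟩ := exists_isTranscendenceBasis K R
  have hsm : Cardinal.mk s = m := hs.cardinalMk_eq_trdeg.trans hR
  obtain ⟨e⟩ : Nonempty (Fin m ≃ s) := Cardinal.eq.1 (by simp [hsm])
  have hx := (isTranscendenceBasis_equiv e).2 hs
  obtain ⟨φ, hφ⟩ := exists_algHom_algebraicIndependent
    (hx.1.map' (f := R.val) Subtype.val_injective)
  exact ⟨φ.comp R.val, AlgHom.injective_of_algebraicIndependent_comp hx _ hφ⟩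
end

section
/- Let K be a field, let m, n be natural numbers with n ≥ m + 1, and let φ₁,…,φ_n ∈ K[x₀,…,x_m] be polynomials in m + 1 variables such that the subalgebra K[φ₁,…,φ_n] they generate has transcendence degree m + 1 over K. For ξ ∈ K let σ_ξ : K[x₀,…,x_m] → K[x₀,…,x_{m−1}] be the K-algebra homomorphism fixing x₀,…,x_{m−1} and sending x_m to the constant ξ. Then the set of ξ ∈ K for which the subalgebra K[σ_ξ(φ₁),…,σ_ξ(φ_n)] does NOT have transcendence degree m over K is finite. -/
open MvPolynomial

/-- The transcendence degree of a subalgebra `S` over `K`. -/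
noncomputable def subTrdeg (K A : Type*) [CommRing K] [CommRing A] [Algebra K A]
    (S : Subalgebra K A) : Cardinal :=
  algTrdeg K ↥S

/-- The specialization `x_m ↦ ξ` of `K[x₀,…,x_m]` into `K[x₀,…,x_{m-1}]`. -/
noncomputable def specialize (K : Type) [Field K] (m : ℕ) (ξ : K) :
    MvPolynomial (Fin (m + 1)) K →ₐ[K] MvPolynomial (Fin m) K :=
  MvPolynomial.aeval fun j : Fin (m + 1) =>
    if h : (j : ℕ) < m then MvPolynomial.X (⟨j, h⟩ : Fin m) else MvPolynomial.C ξ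

/-- A nonzero polynomial has nonzero specialization at all but finitely many `ξ`. -/
theorem finite_setOf_specialize_eq_zero (K : Type) [Field K] (m : ℕ)
    {c : MvPolynomial (Fin (m + 1)) K} (hc : c ≠ 0) :
    {ξ : K | specialize K m ξ c = 0}.Finite := by
  let Φ : MvPolynomial (Fin (m + 1)) K →ₐ[K] Polynomial (MvPolynomial (Fin m) K) :=
    aeval (Fin.lastCases Polynomial.X fun j => Polynomial.C (X j))
  let Ψ : Polynomial (MvPolynomial (Fin m) K) →+* MvPolynomial (Fin (m + 1)) K :=
    Polynomial.eval₂RingHom (rename Fin.castSucc).toRingHom (X (Fin.last m))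
  have hΨ : Ψ.comp Φ.toRingHom = RingHom.id _ := by
    ext j : 2
    · simp [Φ, Ψ, Polynomial.algebraMap_apply, algebraMap_eq]
    · induction j using Fin.lastCases <;> simp [Φ, Ψ]
  have hΦ (ξ : K) : ((Polynomial.evalRingHom (C ξ)).comp Φ.toRingHom) =
      (specialize K m ξ).toRingHom := by
    ext j : 2
    · simp [Φ, specialize, Polynomial.algebraMap_apply, algebraMap_eq]
    · induction j using Fin.lastCases <;> simp [Φ, specialize]
  have hne : Φ c ≠ 0 := fun h => hc <| by
    have := RingHom.congr_fun hΨ c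
    simpa [h] using this.symm
  refine ((Polynomial.finite_setOfPred_isRoot hne).preimage
    (MvPolynomial.C_injective (Fin m) K).injOn).subset fun ξ hξ => ?_
  exact (RingHom.congr_fun (hΦ ξ) c).trans hξ

/-- A subalgebra of a polynomial ring in `d` variables over a field has transcendence degree `d`
if and only if the polynomial ring is algebraic over it. -/
theorem subTrdeg_eq_iff_isAlgebraic (K : Type) [Field K] (d : ℕ)
    (S : Subalgebra K (MvPolynomial (Fin d) K)) :
    subTrdeg K _ S = (d : Cardinal) ↔ Algebra.IsAlgebraic S (MvPolynomial (Fin d) K) := by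
  have h : Algebra.trdeg K S + Algebra.trdeg S (MvPolynomial (Fin d) K) = (d : Cardinal) := by
    rw [trdeg_add_eq]
    simp
  change Algebra.trdeg K S = _ ↔ _
  rw [← trdeg_eq_zero_iff]
  constructor
  · intro hS
    rw [hS] at h
    exact Cardinal.eq_of_add_eq_add_left (h.trans (add_zero _).symm) (Cardinal.natCast_lt_aleph0)
  · intro hS
    rwa [hS, add_zero] at h

/-- If the subalgebra `K[φ₁,…,φₙ]` of `K[x₀,…,x_m]` has transcendence degree `m + 1`, then
for all but finitely many `ξ ∈ K` the specialized subalgebra `K[σ_ξ(φ₁),…,σ_ξ(φₙ)]` has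
transcendence degree `m`. -/
theorem stmt_7 (K : Type) [Field K] (m n : ℕ) (hn : m + 1 ≤ n)
    (φ : Fin n → MvPolynomial (Fin (m + 1)) K)
    (hφ : subTrdeg K _ (Algebra.adjoin K (Set.range φ)) = ((m + 1 : ℕ) : Cardinal)) :
    {ξ : K | subTrdeg K _
        (Algebra.adjoin K (Set.range fun i => specialize K m ξ (φ i))) ≠
          (m : Cardinal)}.Finite := by
  set S := Algebra.adjoin K (Set.range φ)
  rw [subTrdeg_eq_iff_isAlgebraic] at hφ
  choose p hp0 hp using fun j : Fin m => hφ.isAlgebraic (X j.castSucc)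
  have hc (j : Fin m) : ((p j).leadingCoeff : MvPolynomial (Fin (m + 1)) K) ≠ 0 := by
    simpa using hp0 j
  refine (Set.finite_iUnion fun j => finite_setOf_specialize_eq_zero K m (hc j)).subset
    fun ξ hξ => ?_
  by_contra hξ'
  simp only [Set.mem_iUnion, Set.mem_ofPred_eq, not_exists] at hξ'
  refine hξ ((subTrdeg_eq_iff_isAlgebraic K m _).2 ?_)
  set S' := Algebra.adjoin K (Set.range fun i => specialize K m ξ (φ i)) with hS'
  have hmap : S.map (specialize K m ξ) = S' := by
    rw [AlgHom.map_adjoin, ← Set.range_comp, hS']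
    rfl
  let f : S →ₐ[K] S' := ((specialize K m ξ).comp S.val).codRestrict S' fun s =>
    hmap ▸ Subalgebra.mem_map.2 ⟨s, s.2, rfl⟩
  have hX (j : Fin m) : IsAlgebraic S' (X j : MvPolynomial (Fin m) K) := by
    refine ⟨(p j).map f.toRingHom, fun h => hξ' j ?_, ?_⟩
    · have := congrArg (fun q => ((q.coeff (p j).natDegree : S') : MvPolynomial (Fin m) K)) h
      simpa [f] using this
    · have h := congrArg (specialize K m ξ) (hp j)
      have hXj : specialize K m ξ (X j.castSucc) = X j := by simp [specialize]
      rw [map_zero, Polynomial.aeval_def, ← AlgHom.coe_toRingHom, Polynomial.hom_eval₂] at h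
      rw [Polynomial.aeval_def, Polynomial.eval₂_map, ← h]
      simp only [AlgHom.coe_toRingHom, hXj]
      rfl
  refine ⟨fun q => ?_⟩
  induction q using MvPolynomial.induction_on with
  | C a => exact isAlgebraic_algebraMap (algebraMap K S' a)
  | add q r hq hr => exact hq.add hr
  | mul_X q j hq => exact hq.mul (hX j)
end

section
/- Let K be a field, n ≥ 2, A = K[x₁,…,xₙ], and let e'_{ij} (1 ≤ i,j ≤ n) be a subbase of End A: K-algebra endomorphisms of A with e'_{ij} ≠ Ô for all i,j, satisfying e'_{ij}∘e'_{km} = e'_{im} whenever j = k and e'_{ij}∘e'_{km} = Ô whenever j ≠ k, where Ô is the K-algebra endomorphism sending every variable x_i to 0. Then trdeg_K(image e'_{ij}) = 1 for all i,j; i.e., every member of a subbase has rank exactly 1. -/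
open MvPolynomial

/-- The `K`-algebra endomorphism `Ô` of `K[x₁,…,xₙ]` sending every variable to `0`. -/
noncomputable def zeroEnd (K : Type) [Field K] (n : ℕ) :
    MvPolynomial (Fin n) K →ₐ[K] MvPolynomial (Fin n) K :=
  MvPolynomial.aeval fun _ : Fin n => (0 : MvPolynomial (Fin n) K)

namespace MvPolynomial

variable {K σ τ : Type*} [Field K]

theorem mem_idealOfVars_iff_constantCoeff {p : MvPolynomial σ K} :
    p ∈ idealOfVars σ K ↔ constantCoeff p = 0 := by
  rw [← pow_one (idealOfVars σ K), mem_pow_idealOfVars_iff', constantCoeff_eq]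
  refine ⟨fun h => h 0 (by simp), fun h x hx => ?_⟩
  rwa [(Finsupp.degree_eq_zero_iff x).1 (by lia)]

/-- The coefficients of the variables in a polynomial. -/
noncomputable def linearPart : MvPolynomial σ K →ₗ[K] (σ → K) :=
  LinearMap.pi fun i => lcoeff K (Finsupp.single i 1)

theorem linearPart_apply (p : MvPolynomial σ K) (i : σ) :
    linearPart p i = coeff (Finsupp.single i 1) p := rfl

@[simp]
theorem linearPart_C (a : K) : linearPart (C a : MvPolynomial σ K) = 0 := by
  ext i
  classical simp [linearPart_apply, coeff_C, Finsupp.single_eq_zero, eq_comm (a := (0 : σ →₀ ℕ))]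

@[simp]
theorem linearPart_X [DecidableEq σ] (i : σ) :
    linearPart (X i : MvPolynomial σ K) = Pi.single i 1 := by
  ext j
  simp [linearPart_apply, coeff_X, Pi.single_apply, Finsupp.single_left_inj, eq_comm]

theorem linearPart_mul (p q : MvPolynomial σ K) :
    linearPart (p * q) = constantCoeff p • linearPart q + constantCoeff q • linearPart p := by
  classical
  ext i
  simp only [linearPart_apply, coeff_mul, Finsupp.antidiagonal_single, Pi.add_apply, Pi.smul_apply,
    smul_eq_mul, Finset.sum_map]
  simp [Finset.Nat.antidiagonal_succ, constantCoeff_eq, mul_comm (coeff 0 q)]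

theorem mem_idealOfVars_sq_iff {p : MvPolynomial σ K} :
    p ∈ idealOfVars σ K ^ 2 ↔ constantCoeff p = 0 ∧ linearPart p = 0 := by
  rw [mem_pow_idealOfVars_iff', constantCoeff_eq]
  refine ⟨fun h => ⟨h 0 (by simp), ?_⟩, fun h x hx => ?_⟩
  · ext i
    exact h _ (by simp)
  · obtain hx | hx : Finsupp.degree x = 0 ∨ Finsupp.degree x = 1 := by lia
    · rw [(Finsupp.degree_eq_zero_iff x).1 hx]
      exact h.1
    · obtain ⟨i, rfl⟩ := (Finsupp.sum_eq_one_iff x).1 hx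
      exact congrFun h.2 i

theorem eq_zero_of_forall_mem_pow_idealOfVars {p : MvPolynomial σ K}
    (h : ∀ k, p ∈ idealOfVars σ K ^ k) : p = 0 := by
  ext x
  exact (mem_pow_idealOfVars_iff' _ p).1 (h (Finsupp.degree x + 1)) x (by lia)

/-- The map induced on linear parts by an endomorphism fixing the origin. -/
noncomputable def cotangentMap [Fintype σ] (φ : MvPolynomial σ K →ₐ[K] MvPolynomial τ K) :
    (σ → K) →ₗ[K] (τ → K) :=
  Fintype.linearCombination K fun i => linearPart (φ (X i))

theorem linearPart_map [Fintype σ] {φ : MvPolynomial σ K →ₐ[K] MvPolynomial τ K}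
    (hφ : ∀ p, constantCoeff (φ p) = constantCoeff p) (p : MvPolynomial σ K) :
    linearPart (φ p) = cotangentMap φ (linearPart p) := by
  classical
  induction p using MvPolynomial.induction_on with
  | C a => rw [linearPart_C, map_zero, ← algebraMap_eq, AlgHom.commutes, algebraMap_eq,
      linearPart_C]
  | add p q hp hq => simp only [map_add, hp, hq]
  | mul_X p i hp =>
    rw [map_mul, linearPart_mul, linearPart_mul, hφ, hφ]
    simp [cotangentMap]

theorem linearPart_surjective [Finite σ] :
    Function.Surjective (linearPart : MvPolynomial σ K →ₗ[K] (σ → K)) := by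
  classical
  have := Fintype.ofFinite σ
  intro v
  refine ⟨∑ i, v i • X i, ?_⟩
  ext j
  simp [Pi.single_apply]

theorem exists_linearPart_eq [Finite σ] (v : σ → K) :
    ∃ p : MvPolynomial σ K, constantCoeff p = 0 ∧ linearPart p = v := by
  obtain ⟨p, rfl⟩ := linearPart_surjective v
  exact ⟨p - C (constantCoeff p), by simp, by simp⟩

theorem map_mem_pow_idealOfVars {φ : MvPolynomial σ K →ₐ[K] MvPolynomial τ K} {k l : ℕ}
    (hφ : ∀ p ∈ idealOfVars σ K, φ p ∈ idealOfVars τ K ^ l) {p : MvPolynomial σ K}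
    (hp : p ∈ idealOfVars σ K ^ k) : φ p ∈ idealOfVars τ K ^ (l * k) := by
  have h : (idealOfVars σ K).map φ ≤ idealOfVars τ K ^ l := Ideal.map_le_iff_le_comap.2 hφ
  rw [pow_mul]
  refine Ideal.pow_right_mono h k ?_
  rw [← Ideal.map_pow]
  exact Ideal.mem_map_of_mem φ hp

theorem map_eq_zero_of_cotangentMap_eq_zero [Fintype σ]
    {e : MvPolynomial σ K →ₐ[K] MvPolynomial σ K} (he : ∀ p, e (e p) = e p)
    (h0 : ∀ p, constantCoeff (e p) = constantCoeff p) (h : cotangentMap e = 0)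
    {p : MvPolynomial σ K} (hp : constantCoeff p = 0) : e p = 0 := by
  have h2 : ∀ q ∈ idealOfVars σ K, e q ∈ idealOfVars σ K ^ 2 := fun q hq => by
    rw [mem_idealOfVars_sq_iff, h0, linearPart_map h0, h]
    exact ⟨mem_idealOfVars_iff_constantCoeff.1 hq, rfl⟩
  have h3 : ∀ k, e p ∈ idealOfVars σ K ^ (k + 1) := fun k => by
    induction k with
    | zero => simpa [mem_idealOfVars_iff_constantCoeff, h0] using hp
    | succ k ih =>
      rw [← he]
      exact Ideal.pow_le_pow_right (by lia) (map_mem_pow_idealOfVars h2 ih)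
  exact eq_zero_of_forall_mem_pow_idealOfVars fun k => Ideal.pow_le_pow_right (by lia) (h3 k)

/-- Modulo higher order, an idempotent whose linear part has rank one takes values in the powers
of a single element. -/
theorem exists_map_eq_smul_pow_add [Fintype σ]
    {e : MvPolynomial σ K →ₐ[K] MvPolynomial σ K} (he : ∀ p, e (e p) = e p)
    (h0 : ∀ p, constantCoeff (e p) = constantCoeff p) {l : MvPolynomial σ K}
    (hl : constantCoeff l = 0) (h : ∀ w, ∃ c : K, cotangentMap e w = c • linearPart l)
    (k : ℕ) {f : MvPolynomial σ K} (hf : f ∈ idealOfVars σ K ^ k) :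
    ∃ c : K, ∃ g ∈ idealOfVars σ K ^ (k + 1), e f = c • e l ^ k + e g := by
  have hl' := mem_idealOfVars_iff_constantCoeff.2 hl
  have h1 : ∀ a ∈ idealOfVars σ K, ∃ c : K, ∃ g ∈ idealOfVars σ K ^ 2, e a = c • e l + e g := by
    intro a ha
    obtain ⟨c, hc⟩ := h (linearPart a)
    refine ⟨c, e a - c • l, ?_, ?_⟩
    · rw [mem_idealOfVars_sq_iff, map_sub, map_sub, map_smul linearPart, linearPart_map h0, hc, h0,
        mem_idealOfVars_iff_constantCoeff.1 ha, constantCoeff_smul, hl]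
      simp
    · rw [map_sub, he, map_smul]
      ring
  induction k generalizing f with
  | zero =>
    refine ⟨constantCoeff f, f - C (constantCoeff f), ?_, ?_⟩
    · simp [mem_idealOfVars_iff_constantCoeff]
    · rw [map_sub, ← algebraMap_eq, AlgHom.commutes, pow_zero, Algebra.algebraMap_eq_smul_one]
      ring
  | succ k ih =>
    rw [pow_succ] at hf
    refine Submodule.mul_induction_on hf ?_ ?_
    · intro p hp a ha
      obtain ⟨c, g, hg, hc⟩ := ih hp
      obtain ⟨d, g', hg', hd⟩ := h1 a ha
      refine ⟨c * d, c • (l ^ k * g') + d • (g * l) + g * g', ?_, ?_⟩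
      · refine Ideal.add_mem _ (Ideal.add_mem _ ?_ ?_) ?_
        · exact Submodule.smul_of_tower_mem _ c
            (pow_add (idealOfVars σ K) k 2 ▸ Ideal.mul_mem_mul (Ideal.pow_mem_pow hl' k) hg')
        · exact Submodule.smul_of_tower_mem _ d
            (pow_succ (idealOfVars σ K) (k + 1) ▸ Ideal.mul_mem_mul hg hl')
        · refine Ideal.pow_le_pow_right (by lia : k + 1 + 1 ≤ k + 1 + 2) ?_
          rw [pow_add _ (k + 1) 2]
          exact Ideal.mul_mem_mul hg hg'
      · simp only [map_add, map_smul, map_mul, map_pow, hc, hd]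
        simp only [smul_eq_C_mul, map_mul]
        ring
    · rintro p q ⟨c, g, hg, hc⟩ ⟨d, g', hg', hd⟩
      refine ⟨c + d, g + g', Ideal.add_mem _ hg hg', ?_⟩
      rw [map_add, map_add, hc, hd, add_smul]
      ring

open Polynomial in
/-- Restriction of polynomials to the `i`-th coordinate axis. -/
noncomputable def restrictAxis [DecidableEq σ] (i : σ) : MvPolynomial σ K →ₐ[K] K[X] :=
  aeval (Pi.single i Polynomial.X)

theorem coeff_zero_restrictAxis [DecidableEq σ] (i : σ) (p : MvPolynomial σ K) :
    (restrictAxis i p).coeff 0 = constantCoeff p := by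
  induction p using MvPolynomial.induction_on with
  | C a => simp [restrictAxis]
  | add p q hp hq => simp [hp, hq]
  | mul_X p j hp =>
    rw [map_mul, Polynomial.mul_coeff_zero]
    by_cases h : j = i <;> simp [restrictAxis, h]

theorem coeff_one_restrictAxis [DecidableEq σ] (i : σ) (p : MvPolynomial σ K) :
    (restrictAxis i p).coeff 1 = linearPart p i := by
  induction p using MvPolynomial.induction_on with
  | C a => simp [restrictAxis, Polynomial.algebraMap_eq]
  | add p q hp hq => simp [hp, hq]
  | mul_X p j hp =>
    rw [map_mul, Polynomial.mul_coeff_one, linearPart_mul, coeff_zero_restrictAxis,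
      coeff_zero_restrictAxis]
    by_cases h : j = i
    · simp [restrictAxis, h]
    · simp [restrictAxis, h, Ne.symm h]

theorem X_pow_dvd_restrictAxis [DecidableEq σ] (i : σ) {k : ℕ} {p : MvPolynomial σ K}
    (hp : p ∈ idealOfVars σ K ^ k) : Polynomial.X ^ k ∣ restrictAxis i p := by
  have h : (idealOfVars σ K).map (restrictAxis i) ≤ Ideal.span {(Polynomial.X : Polynomial K)} := by
    refine Ideal.map_le_iff_le_comap.2 fun q hq => ?_
    rw [Ideal.mem_comap, Ideal.mem_span_singleton, Polynomial.X_dvd_iff, coeff_zero_restrictAxis]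
    exact mem_idealOfVars_iff_constantCoeff.1 hq
  rw [← Ideal.mem_span_singleton, ← Ideal.span_singleton_pow]
  refine Ideal.pow_right_mono h k ?_
  rw [← Ideal.map_pow]
  exact Ideal.mem_map_of_mem _ hp

theorem map_eq_zero_of_restrictAxis_eq_zero [Fintype σ] [DecidableEq σ]
    {e : MvPolynomial σ K →ₐ[K] MvPolynomial σ K} (he : ∀ p, e (e p) = e p)
    (h0 : ∀ p, constantCoeff (e p) = constantCoeff p) {v : σ → K} (hv : cotangentMap e v = v)
    (h : ∀ w, ∃ c : K, cotangentMap e w = c • v) {i : σ} (hi : v i ≠ 0)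
    {f : MvPolynomial σ K} (hf : restrictAxis i (e f) = 0) : e f = 0 := by
  obtain ⟨l, hl, rfl⟩ := exists_linearPart_eq v
  obtain ⟨s, hs⟩ : Polynomial.X ∣ restrictAxis i (e l) := by
    rw [Polynomial.X_dvd_iff, coeff_zero_restrictAxis, h0, hl]
  have hs0 : s.coeff 0 ≠ 0 := by
    rwa [← Polynomial.coeff_X_mul, ← hs, coeff_one_restrictAxis, linearPart_map h0, hv]
  have key : ∀ k, ∃ g ∈ idealOfVars σ K ^ k, e f = e g := fun k => by
    induction k with
    | zero => exact ⟨f, by simp, rfl⟩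
    | succ k ih =>
      obtain ⟨g, hg, hfg⟩ := ih
      obtain ⟨c, g', hg', hc⟩ := exists_map_eq_smul_pow_add he h0 hl h k hg
      have heg' : e g' ∈ idealOfVars σ K ^ (k + 1) := by
        simpa using map_mem_pow_idealOfVars (l := 1) (fun p hp => by
          simpa [mem_idealOfVars_iff_constantCoeff, h0] using hp) hg'
      obtain ⟨r, hr⟩ := X_pow_dvd_restrictAxis i heg'
      rw [hfg, hc, map_add, map_smul, map_pow, hs, hr] at hf
      have h1 : Polynomial.X ^ k * (c • s ^ k + Polynomial.X * r) = 0 := by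
        rw [← hf, Polynomial.smul_eq_C_mul, Polynomial.smul_eq_C_mul]
        ring
      have h2 := congrArg (Polynomial.coeff · 0)
        ((mul_eq_zero.1 h1).resolve_left (pow_ne_zero k Polynomial.X_ne_zero))
      have hc0 : c = 0 := by
        rw [Polynomial.coeff_zero_eq_eval_zero] at hs0
        simpa [Polynomial.coeff_zero_eq_eval_zero, hs0] using h2
      exact ⟨g', hg', by rw [hfg, hc, hc0, zero_smul, zero_add]⟩
  refine eq_zero_of_forall_mem_pow_idealOfVars fun k => ?_
  obtain ⟨g, hg, hfg⟩ := key k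
  rw [hfg]
  simpa using map_mem_pow_idealOfVars (l := 1) (fun p hp => by
    simpa [mem_idealOfVars_iff_constantCoeff, h0] using hp) hg

theorem trdeg_range_le_one [Fintype σ]
    {e : MvPolynomial σ K →ₐ[K] MvPolynomial σ K} (he : ∀ p, e (e p) = e p)
    (h0 : ∀ p, constantCoeff (e p) = constantCoeff p) {v : σ → K} (hv0 : v ≠ 0)
    (hv : cotangentMap e v = v) (h : ∀ w, ∃ c : K, cotangentMap e w = c • v) :
    Algebra.trdeg K e.range ≤ 1 := by
  classical
  obtain ⟨i, hi⟩ := Function.ne_iff.1 hv0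
  have hinj : Function.Injective ((restrictAxis i).comp e.range.val) := by
    rw [injective_iff_map_eq_zero]
    rintro ⟨_, f, rfl⟩ hf
    exact Subtype.ext (map_eq_zero_of_restrictAxis_eq_zero he h0 hv h hi hf)
  simpa using lift_trdeg_le_of_injective _ hinj

theorem transcendental_of_constantCoeff_eq_zero {p : MvPolynomial σ K} (hp : p ≠ 0)
    (h0 : constantCoeff p = 0) : Transcendental K p := fun h => by
  have := (IsIntegral.isUnit h.isIntegral hp).map (constantCoeff (R := K) (σ := σ))
  rw [h0] at this
  exact not_isUnit_zero this

end MvPolynomial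

/-- If there are as many nonzero orthogonal idempotents as the dimension, each has rank one. -/
theorem exists_smul_of_orthogonal_idempotents {K V ι : Type*} [Field K] [AddCommGroup V]
    [Module K V] [FiniteDimensional K V] [Fintype ι] (hV : Fintype.card ι = Module.finrank K V)
    {p : ι → V →ₗ[K] V} (hp : ∀ i, p i ≠ 0) (hpp : ∀ i v, p i (p i v) = p i v)
    (hpq : ∀ i j, i ≠ j → ∀ v, p i (p j v) = 0) (i : ι) :
    ∃ v, v ≠ 0 ∧ p i v = v ∧ ∀ w, ∃ c : K, p i w = c • v := by
  classical
  have hex : ∀ i, ∃ v, p i v ≠ 0 := fun i => by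
    by_contra! h
    exact hp i (LinearMap.ext h)
  choose v hv using hex
  have hb (i j : ι) : p i (p j (v j)) = if i = j then p i (v i) else 0 := by
    split_ifs with h
    · rw [h, hpp]
    · exact hpq i j h _
  have hli : LinearIndependent K fun j => p j (v j) := by
    rw [Fintype.linearIndependent_iff]
    intro g hg i
    have := congrArg (p i) hg
    simpa [hb, hv] using this
  let b := basisOfLinearIndependentOfCardEqFinrank' _ hli hV
  refine ⟨p i (v i), hv i, hpp i _, fun w => ⟨b.repr w i, ?_⟩⟩
  conv_lhs => rw [← b.sum_repr w]
  simp [b, hb]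

/-- Every member of a subbase of `End K[x₁,…,xₙ]` has rank exactly `1`. -/
theorem stmt_11 (K : Type) [Field K] (n : ℕ) (hn : 2 ≤ n)
    (e : Fin n → Fin n → (MvPolynomial (Fin n) K →ₐ[K] MvPolynomial (Fin n) K))
    (hne : ∀ i j, e i j ≠ zeroEnd K n)
    (hee : ∀ i j k l, (e i j).comp (e k l) = if j = k then e i l else zeroEnd K n) :
    ∀ i j, algTrdeg K ↥(e i j).range = 1 := by
  have hO (p) : zeroEnd K n p = C (constantCoeff p) := by
    rw [zeroEnd, aeval_zero', algebraMap_eq]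
  have hcomp (i j k l p) : e i j (e k l p) = if j = k then e i l p else C (constantCoeff p) := by
    rw [← AlgHom.comp_apply, hee]
    split_ifs
    · rfl
    · exact hO p
  have : Nontrivial (Fin n) := Fin.nontrivial_iff_two_le.2 hn
  have h0 (i j p) : constantCoeff (e i j p) = constantCoeff p := by
    obtain ⟨k, hk⟩ := exists_ne i
    have h1 := hcomp k k i j p
    have h2 := hcomp k k i i (e i j p)
    rw [hcomp i i i j, if_pos rfl, if_neg hk, h1, if_neg hk] at h2
    exact (C_injective _ _ h2).symm
  have hidem (i p) : e i i (e i i p) = e i i p := by simp [hcomp]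
  have hne' (i j) : ∃ k, e i j (X k) ≠ 0 := by
    by_contra! h
    exact hne i j (algHom_ext fun k => by rw [h, hO]; simp)
  have hrank := exists_smul_of_orthogonal_idempotents (K := K) (p := fun i => cotangentMap (e i i))
    (by simp)
    (fun i h => by
      obtain ⟨k, hk⟩ := hne' i i
      exact hk (map_eq_zero_of_cotangentMap_eq_zero (hidem i) (h0 i i) h (by simp)))
    (fun i v => by
      obtain ⟨l, rfl⟩ := linearPart_surjective v
      simp only [← linearPart_map (h0 i i), hidem])
    (fun i j hij v => by
      obtain ⟨l, rfl⟩ := linearPart_surjective v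
      simp only [← linearPart_map (h0 _ _), hcomp, if_neg hij, linearPart_C])
  intro i j
  change Algebra.trdeg K (e i j).range = 1
  have hle : (e i j).range ≤ (e i i).range := by
    rintro _ ⟨p, rfl⟩
    exact ⟨e i j p, by simp [hcomp]⟩
  apply le_antisymm
  · obtain ⟨v, hv0, hv, h⟩ := hrank i
    exact (trdeg_le_of_injective _ (Subalgebra.inclusion_injective hle)).trans
      (trdeg_range_le_one (hidem i) (h0 i i) hv0 hv h)
  · obtain ⟨k, hk⟩ := hne' i j
    have : Algebra.Transcendental K (e i j).range :=
      ⟨⟨e i j (X k), X k, rfl⟩, fun h => transcendental_of_constantCoeff_eq_zero hk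
        (by simp [h0]) (h.algHom (e i j).range.val)⟩
    exact Cardinal.one_le_iff_pos.2 (trdeg_pos K _)
end

section
/- Let K be a field, n ≥ 2, A = K[x₁,…,xₙ], and Φ an automorphism of the monoid End A of K-algebra endomorphisms of A. Let e_{ij} be the Kronecker endomorphisms of A in the standard base (e_{ij}(x_k) = x_i if k = j, and 0 otherwise). Then the family Φ(e_{ij}) is a base of End A; in particular: Φ(e_{ij}) ∘ Φ(e_{km}) = Φ(e_{im}) whenever j = k, each Φ(e_{ij}) has rank 1 (trdeg_K(image Φ(e_{ij})) = 1), and there exist z₁,…,zₙ ∈ A forming a base of A such that image(Φ(e_{ii})) ⊆ K[z_i] for every i. -/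
open MvPolynomial

/-- The Kronecker endomorphism `e_{ij}` of `K[x₁,…,xₙ]` in the standard base:
`x_j ↦ x_i` and `x_k ↦ 0` for `k ≠ j`. -/
noncomputable def kron (K : Type) [Field K] (n : ℕ) (i j : Fin n) :
    MvPolynomial (Fin n) K →ₐ[K] MvPolynomial (Fin n) K :=
  MvPolynomial.aeval fun k : Fin n =>
    if k = j then MvPolynomial.X i else (0 : MvPolynomial (Fin n) K)

section Retract

variable {K : Type*} [Field K]

/-- A nonconstant polynomial stays nonconstant under some substitution by univariate polynomials. -/
theorem exists_algHom_natDegree_ne_zero {σ : Type*} (b : MvPolynomial σ K)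
    (hb : ∀ c, b ≠ C c) :
    ∃ u : MvPolynomial σ K →ₐ[K] Polynomial K, (u b).natDegree ≠ 0 := by
  by_contra! h
  set c := constantCoeff b with hc
  let q : MvPolynomial σ (Polynomial K) :=
    eval₂Hom (C.comp Polynomial.C) (fun i => C Polynomial.X * X i) b
  have hq : q = C (Polynomial.C c) := by
    refine MvPolynomial.funext fun s => ?_
    have h1 : eval s q = aeval (R := K) (fun i => Polynomial.X * s i) b := by
      have : (eval s).comp (eval₂Hom (C.comp Polynomial.C) (fun i => C Polynomial.X * X i)) =
          ((aeval (R := K) fun i => Polynomial.X * s i : MvPolynomial σ K →ₐ[K] Polynomial K) :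
            MvPolynomial σ K →+* Polynomial K) := by
        ext <;> simp [Polynomial.algebraMap_eq]
      exact DFunLike.congr_fun this b
    have h2 : Polynomial.eval 0 (aeval (R := K) (fun i => Polynomial.X * s i) b) = c := by
      have : (Polynomial.aeval (0 : K)).comp (aeval (R := K) (fun i => Polynomial.X * s i)) =
          (aeval (0 : σ → K)) := by ext i; simp
      have := DFunLike.congr_fun this b
      simpa [hc] using this
    rw [h1, Polynomial.eq_C_of_natDegree_eq_zero (h (aeval fun i => Polynomial.X * s i)), eval_C]
    rw [Polynomial.coeff_zero_eq_eval_zero, h2]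
  refine hb c ?_
  have h3 : (map (Polynomial.evalRingHom 1)).comp
      (eval₂Hom (C.comp Polynomial.C) (fun i => C Polynomial.X * X i)) =
      RingHom.id (MvPolynomial σ K) := by
    ext <;> simp
  have h4 := DFunLike.congr_fun h3 b
  change map _ q = b at h4
  rw [← h4, hq]
  simp

theorem Polynomial.transcendental_of_natDegree_ne_zero {f : Polynomial K}
    (hf : f.natDegree ≠ 0) : Transcendental K f := by
  simpa using (Polynomial.transcendental_X K).aeval f hf
    (by simp [Polynomial.ne_zero_of_natDegree_gt (Nat.pos_of_ne_zero hf)])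

theorem MvPolynomial.transcendental_of_forall_ne_C {σ : Type*} {b : MvPolynomial σ K}
    (hb : ∀ c, b ≠ C c) : Transcendental K b := by
  obtain ⟨u, hu⟩ := exists_algHom_natDegree_ne_zero b hb
  intro h
  exact Polynomial.transcendental_of_natDegree_ne_zero hu (h.algHom u)

/-- Irreducible elements of a retract of a unique factorization domain are prime. -/
theorem Irreducible.prime_of_retract {A B : Type*} [CommRing A] [IsDomain A]
    [UniqueFactorizationMonoid A] [CommRing B] [IsDomain B] (ι : B →+* A) (ρ : A →+* B)
    (h : ∀ b, ρ (ι b) = b) {s : B} (hs : Irreducible s) : Prime s := by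
  have hι : Function.Injective ι := Function.LeftInverse.injective h
  obtain ⟨f, hf, hfs⟩ := UniqueFactorizationMonoid.exists_prime_factors (ι s)
    (by rw [Ne, map_eq_zero_iff ι hι]; exact hs.ne_zero)
  have hfs' : Associated (f.map ρ).prod s := by
    rw [← map_multiset_prod, ← h s]
    exact hfs.map ρ
  have key : ∀ f : Multiset A, Irreducible (f.map ρ).prod →
      ∃ q ∈ f, Associated (ρ q) (f.map ρ).prod := by
    intro f
    induction f using Multiset.induction with
    | empty => intro h; exact absurd h (by simp)
    | cons a f ih =>
      intro hi
      rw [Multiset.map_cons, Multiset.prod_cons] at hi ⊢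
      rcases hi.isUnit_or_isUnit rfl with hu | hu
      · obtain ⟨q, hq, hq'⟩ := ih ((irreducible_isUnit_mul hu).1 hi)
        exact ⟨q, Multiset.mem_cons_of_mem hq, hq'.trans (associated_unit_mul_right _ _ hu)⟩
      · exact ⟨a, Multiset.mem_cons_self a f, associated_mul_unit_right _ _ hu⟩
  obtain ⟨q, hq, hqs⟩ := key f (hfs'.irreducible_iff.2 hs)
  have hqs := hqs.trans hfs'
  have hqd : q ∣ ι s := (Multiset.dvd_prod hq).trans hfs.dvd
  refine ⟨hs.ne_zero, hs.not_isUnit, fun a b hab => ?_⟩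
  have : q ∣ ι a * ι b := by rw [← map_mul]; exact hqd.trans (map_dvd ι hab)
  refine ((hf q hq).dvd_or_dvd this).imp (fun hd => ?_) (fun hd => ?_) <;>
  · have := map_dvd ρ hd
    rw [h] at this
    exact hqs.symm.dvd.trans this

/-- The polynomial ring is integral over the subalgebra generated by a nonconstant polynomial. -/
theorem Polynomial.isIntegral_aeval_of_natDegree_ne_zero {g : Polynomial K} (hg : g.natDegree ≠ 0) :
    (Polynomial.aeval g : Polynomial K →ₐ[K] Polynomial K).toRingHom.IsIntegral := by
  set ψ := (Polynomial.aeval g : Polynomial K →ₐ[K] Polynomial K).toRingHom with hψ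
  let := ψ.toAlgebra
  have hg0 : g ≠ 0 := by rintro rfl; simp at hg
  have hX : ψ.IsIntegralElem Polynomial.X := by
    have ha : g.leadingCoeff⁻¹ * g.leadingCoeff = 1 :=
      inv_mul_cancel₀ (Polynomial.leadingCoeff_ne_zero.2 hg0)
    set a := g.leadingCoeff⁻¹
    have hmonic : (Polynomial.C a * g).Monic := Polynomial.monic_C_mul_of_mul_leadingCoeff_eq_one ha
    refine ⟨(Polynomial.C a * g).map Polynomial.C -
      Polynomial.C (Polynomial.C a * Polynomial.X), (hmonic.map _).sub_of_left ?_, ?_⟩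
    · refine Polynomial.degree_C_le.trans_lt (Polynomial.natDegree_pos_iff_degree_pos.1 ?_)
      rw [hmonic.natDegree_map, Polynomial.natDegree_C_mul (left_ne_zero_of_mul_eq_one ha)]
      exact Nat.pos_of_ne_zero hg
    · have : ψ.comp Polynomial.C = Polynomial.C := by ext; simp [hψ]
      rw [Polynomial.eval₂_sub, Polynomial.eval₂_map, this]
      simp [hψ, Polynomial.eval₂_C_X]
  intro f
  induction f using Polynomial.induction_on' with
  | add p q hp hq => exact hp.add ψ hq
  | monomial n a =>
    rw [← Polynomial.C_mul_X_pow_eq_monomial]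
    refine RingHom.IsIntegralElem.mul ψ ?_ ?_
    · have : Polynomial.C a = ψ (Polynomial.C a) := by simp [hψ]
      rw [this]
      exact ψ.isIntegralElem_map
    · exact IsIntegral.pow hX n

/-- A subalgebra of `K[t]` in which irreducible elements are prime is generated by one element. -/
theorem exists_adjoin_singleton_eq_top {B : Type*} [CommRing B] [IsDomain B] [Algebra K B]
    (v : B →ₐ[K] Polynomial K) (hv : Function.Injective v)
    (hB : ∀ s : B, Irreducible s → Prime s) (b : B) (hb : (v b).natDegree ≠ 0) :
    ∃ s : B, (v s).natDegree ≠ 0 ∧ Algebra.adjoin K {s} = ⊤ := by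
  let ε : B →ₐ[K] K := (Polynomial.aeval (0 : K)).comp v
  have hε : ∀ f, ε (f - algebraMap K B (ε f)) = 0 := by intro f; simp
  have hdeg : ∀ f, (v f).natDegree = 0 → f = algebraMap K B (ε f) := by
    intro f hf
    apply hv
    rw [AlgHom.commutes, Polynomial.eq_C_of_natDegree_eq_zero hf]
    simp [ε, Polynomial.coeff_zero_eq_aeval_zero]
  have hdeg' : ∀ f c, (v (f - algebraMap K B c)).natDegree = (v f).natDegree := by
    intro f c
    simp [Polynomial.algebraMap_eq]
  have hex : ∃ d, ∃ s : B, s ≠ 0 ∧ ε s = 0 ∧ (v s).natDegree = d := by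
    refine ⟨_, b - algebraMap K B (ε b), ?_, hε b, rfl⟩
    intro h
    have := hdeg' b (ε b)
    rw [h] at this
    simp at this
    exact hb this.symm
  classical
  obtain ⟨s, hs0, hs, hsd⟩ := Nat.find_spec hex
  have hmin : ∀ f : B, f ≠ 0 → ε f = 0 → (v s).natDegree ≤ (v f).natDegree := fun f h0 hf =>
    hsd ▸ Nat.find_min' hex ⟨f, h0, hf, rfl⟩
  have hd : (v s).natDegree ≠ 0 := by
    intro h
    apply hs0
    rw [hdeg s h, hs, map_zero]
  have hv0 : ∀ f, f ≠ 0 → v f ≠ 0 := fun f hf => by rwa [Ne, map_eq_zero_iff v hv]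
  have hirr : Irreducible s := by
    refine ⟨fun hu => ?_, fun f g hfg => ?_⟩
    · have := hu.map ε
      rw [hs] at this
      exact not_isUnit_zero this
    · have hf0 : f ≠ 0 := by rintro rfl; simp at hfg; exact hs0 hfg
      have hg0 : g ≠ 0 := by rintro rfl; simp at hfg; exact hs0 hfg
      have hunit : ∀ g, g ≠ 0 → (v g).natDegree = 0 → IsUnit g := by
        intro g hg0 hg
        rw [hdeg g hg]
        refine IsUnit.map _ (isUnit_iff_ne_zero.2 fun h => hg0 ?_)
        rw [hdeg g hg, h, map_zero]
      have hadd : (v s).natDegree = (v f).natDegree + (v g).natDegree := by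
        rw [hfg, map_mul, Polynomial.natDegree_mul (hv0 f hf0) (hv0 g hg0)]
      have : ε f * ε g = 0 := by rw [← map_mul, ← hfg, hs]
      rcases mul_eq_zero.1 this with h | h
      · have := hmin f hf0 h
        exact Or.inr (hunit g hg0 (by omega))
      · have := hmin g hg0 h
        exact Or.inl (hunit f hf0 (by omega))
  have hp := hB s hirr
  let I : Ideal B := Ideal.span {s}
  have : I.IsPrime := (Ideal.span_singleton_prime hs0).2 hp
  have hint : Algebra.IsIntegral K (B ⧸ I) := by
    refine ⟨fun y => ?_⟩
    obtain ⟨f, rfl⟩ := Ideal.Quotient.mk_surjective y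
    obtain ⟨P, hP, hPf⟩ := Polynomial.isIntegral_aeval_of_natDegree_ne_zero hd (v f)
    let ψ : Polynomial K →+* B := (Polynomial.aeval s : Polynomial K →ₐ[K] B).toRingHom
    have h1 : (Polynomial.aeval (v s) : Polynomial K →ₐ[K] Polynomial K).toRingHom =
        (v : B →+* Polynomial K).comp ψ := by
      ext <;> simp [ψ]
    have h2 : Polynomial.eval₂ ψ f P = 0 := by
      apply hv
      rw [h1] at hPf
      rw [map_zero, ← hPf]
      exact Polynomial.hom_eval₂ P ψ (v : B →+* Polynomial K) f
    have h3 : (algebraMap K (B ⧸ I)).comp (Polynomial.evalRingHom 0) =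
        (Ideal.Quotient.mk I).comp ψ := by
      have hs : Ideal.Quotient.mk I s = 0 :=
        Ideal.Quotient.eq_zero_iff_mem.2 (Ideal.mem_span_singleton_self s)
      ext
      · simp [ψ]
      · simp [ψ, hs]
    refine ⟨P.map (Polynomial.evalRingHom 0), hP.map _, ?_⟩
    rw [Polynomial.eval₂_map, h3, ← Polynomial.hom_eval₂, h2, map_zero]
  have hmax : I.IsMaximal := Ideal.Quotient.maximal_of_isField _
    (isField_of_isIntegral_of_isField' (Field.toIsField K))
  have hI : I = RingHom.ker ε := by
    refine hmax.eq_of_le (RingHom.ker_ne_top _) ?_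
    rw [Ideal.span_singleton_le_iff_mem]
    exact hs
  refine ⟨s, hd, top_unique fun f _ => ?_⟩
  induction hn : (v f).natDegree using Nat.strong_induction_on generalizing f with
  | _ n ih =>
  by_cases hf : (v f).natDegree = 0
  · rw [hdeg f hf]
    exact Subalgebra.algebraMap_mem _ _
  have hmem : f - algebraMap K B (ε f) ∈ I := by rw [hI]; exact hε f
  obtain ⟨g, hg⟩ := Ideal.mem_span_singleton'.1 hmem
  have hg0 : g ≠ 0 := by
    rintro rfl
    have := hdeg' f (ε f)
    rw [← hg] at this
    simp at this
    exact hf this.symm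
  have hgn : (v g).natDegree + (v s).natDegree = n := by
    rw [← hn, ← hdeg' f (ε f), ← hg, map_mul, Polynomial.natDegree_mul (hv0 g hg0) (hv0 s hs0)]
  have := ih _ (by omega) g trivial rfl
  rw [← sub_add_cancel f (algebraMap K B (ε f)), ← hg]
  exact add_mem (mul_mem this (Algebra.self_mem_adjoin_singleton K s))
    (Subalgebra.algebraMap_mem _ _)

theorem MvPolynomial.transcendental_iff_forall_ne_C {σ : Type*} {b : MvPolynomial σ K} :
    Transcendental K b ↔ ∀ c, b ≠ C c := by
  refine ⟨fun h c hc => h ?_, MvPolynomial.transcendental_of_forall_ne_C⟩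
  rw [hc]
  exact isAlgebraic_algebraMap c

/-- An endomorphism is fixed by all left compositions iff it takes only constant values. -/
theorem forall_mul_eq_iff {σ : Type*} {c : MvPolynomial σ K →ₐ[K] MvPolynomial σ K} :
    (∀ φ : MvPolynomial σ K →ₐ[K] MvPolynomial σ K, φ * c = c) ↔
      ∀ a, ∃ k, c a = C k := by
  refine ⟨fun h a => ⟨aeval (0 : σ → K) (c a), ?_⟩, fun h φ => AlgHom.ext fun a => ?_⟩
  · have := DFunLike.congr_fun
      (h ((Algebra.ofId K (MvPolynomial σ K)).comp (aeval (0 : σ → K)))) a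
    exact this.symm
  · obtain ⟨k, hk⟩ := h a
    rw [AlgHom.mul_apply, hk]
    exact φ.commutes k

/-- A nonconstant idempotent `p` such that every endomorphism which is nonconstant on the image of
`p` is left cancellable on that image has as image a polynomial ring in one variable. -/
theorem exists_range_eq_adjoin_singleton {σ : Type*} [Nonempty σ]
    (p : MvPolynomial σ K →ₐ[K] MvPolynomial σ K) (hp : p * p = p)
    (hc : ¬ ∀ φ : MvPolynomial σ K →ₐ[K] MvPolynomial σ K, φ * p = p)
    (hcancel : ∀ θ : MvPolynomial σ K →ₐ[K] MvPolynomial σ K,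
      (¬ ∀ φ : MvPolynomial σ K →ₐ[K] MvPolynomial σ K, φ * (θ * p) = θ * p) →
      ∀ φ ψ : MvPolynomial σ K →ₐ[K] MvPolynomial σ K,
        θ * (p * φ) = θ * (p * ψ) → p * φ = p * ψ) :
    ∃ z, Transcendental K z ∧ p.range = Algebra.adjoin K {z} := by
  have hpp : ∀ a, p (p a) = p a := fun a => DFunLike.congr_fun hp a
  obtain ⟨j⟩ := ‹Nonempty σ›
  rw [forall_mul_eq_iff] at hc
  push Not at hc
  obtain ⟨a, ha⟩ := hc
  obtain ⟨u, hu⟩ := exists_algHom_natDegree_ne_zero (p a) ha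
  let θ : MvPolynomial σ K →ₐ[K] MvPolynomial σ K := (Polynomial.aeval (X j)).comp u
  have hθ : ¬ ∀ φ : MvPolynomial σ K →ₐ[K] MvPolynomial σ K, φ * (θ * p) = θ * p := by
    rw [forall_mul_eq_iff]
    intro h
    obtain ⟨k, hk⟩ := h a
    refine MvPolynomial.transcendental_iff_forall_ne_C.1
      ((transcendental_X K j).aeval_of_transcendental
        (Polynomial.transcendental_of_natDegree_ne_zero hu)) k hk
  have hker : ∀ w, p w = w → u w = 0 → w = 0 := by
    intro w hw hw0
    have := hcancel θ hθ (aeval fun _ => w) (aeval fun _ => 0) (by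
      ext i
      simp [hw, θ, hw0])
    simpa [hw] using DFunLike.congr_fun this (X j)
  let v : p.range →ₐ[K] Polynomial K := u.comp p.range.val
  have hv : Function.Injective v := by
    rw [injective_iff_map_eq_zero]
    rintro ⟨_, w, rfl⟩ hw
    exact Subtype.ext (hker _ (hpp w) hw)
  have hret : ∀ b : p.range, p.rangeRestrict (p.range.val b) = b := by
    rintro ⟨_, w, rfl⟩
    exact Subtype.ext (hpp w)
  obtain ⟨s, hs, htop⟩ := exists_adjoin_singleton_eq_top v hv
    (fun s => Irreducible.prime_of_retract (p.range.val : p.range →+* MvPolynomial σ K)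
      (p.rangeRestrict : MvPolynomial σ K →+* p.range) hret)
    ⟨p a, a, rfl⟩ hu
  refine ⟨s, ?_, ?_⟩
  · intro h
    exact Polynomial.transcendental_of_natDegree_ne_zero hs (h.algHom u)
  · have := congrArg (Subalgebra.map p.range.val) htop
    rw [AlgHom.map_adjoin, Set.image_singleton, Algebra.map_top, Subalgebra.range_val] at this
    exact this.symm

end Retract

section Kronecker

variable {K : Type} [Field K] {n : ℕ}

theorem kron_mul_kron (i j l : Fin n) : kron K n i j * kron K n j l = kron K n i l := by
  ext k : 1
  by_cases h : k = l <;> simp [kron, h]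

theorem kron_self_apply_X (i : Fin n) : kron K n i i (X i) = X i := by
  simp [kron]

theorem kron_self_apply (i : Fin n) (a : MvPolynomial (Fin n) K) :
    ∃ q : Polynomial K, kron K n i i a = Polynomial.aeval (X i) q := by
  refine ⟨aeval (fun k => if k = i then Polynomial.X else 0) a, ?_⟩
  rw [← AlgHom.comp_apply]
  congr 1
  ext k : 1
  by_cases h : k = i <;> simp [kron, h]

theorem not_forall_mul_kron_self_eq (i : Fin n) :
    ¬ ∀ φ : MvPolynomial (Fin n) K →ₐ[K] MvPolynomial (Fin n) K,
      φ * kron K n i i = kron K n i i := by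
  rw [forall_mul_eq_iff]
  intro h
  obtain ⟨k, hk⟩ := h (X i)
  rw [kron_self_apply_X] at hk
  exact MvPolynomial.transcendental_iff_forall_ne_C.1 (transcendental_X K i) k hk

theorem kron_self_cancel (i : Fin n) (θ : MvPolynomial (Fin n) K →ₐ[K] MvPolynomial (Fin n) K)
    (hθ : ¬ ∀ φ : MvPolynomial (Fin n) K →ₐ[K] MvPolynomial (Fin n) K,
      φ * (θ * kron K n i i) = θ * kron K n i i)
    (φ ψ : MvPolynomial (Fin n) K →ₐ[K] MvPolynomial (Fin n) K)
    (h : θ * (kron K n i i * φ) = θ * (kron K n i i * ψ)) :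
    kron K n i i * φ = kron K n i i * ψ := by
  have htr : Transcendental K (θ (X i)) := by
    rw [MvPolynomial.transcendental_iff_forall_ne_C]
    rintro c hc
    refine hθ (forall_mul_eq_iff.2 fun a => ?_)
    obtain ⟨q, hq⟩ := kron_self_apply i a
    refine ⟨q.eval c, ?_⟩
    rw [AlgHom.mul_apply, hq, ← Polynomial.aeval_algHom_apply, hc]
    exact Polynomial.aeval_algebraMap_apply_eq_algebraMap_eval c q
  ext a : 1
  have ha := DFunLike.congr_fun h (X a)
  simp only [AlgHom.mul_apply] at ha ⊢
  obtain ⟨q, hq⟩ := kron_self_apply i (φ (X a))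
  obtain ⟨r, hr⟩ := kron_self_apply i (ψ (X a))
  rw [hq, hr, ← Polynomial.aeval_algHom_apply, ← Polynomial.aeval_algHom_apply] at ha
  rw [hq, hr, transcendental_iff_injective.1 htr ha]

/-- The algebra `K[x₁,…,xₙ]` is the coproduct of the images of the idempotents `e_{ii}`. -/
theorem existsUnique_mul_kron_self
    (φ : Fin n → MvPolynomial (Fin n) K →ₐ[K] MvPolynomial (Fin n) K) :
    ∃! ψ : MvPolynomial (Fin n) K →ₐ[K] MvPolynomial (Fin n) K,
      ∀ i, ψ * kron K n i i = φ i * kron K n i i := by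
  refine ⟨aeval fun i => φ i (X i), fun i => ?_, fun ψ hψ => ?_⟩
  · ext k : 1
    by_cases h : k = i <;> simp [kron, h]
  · ext i : 1
    have := DFunLike.congr_fun (hψ i) (X i)
    rw [AlgHom.mul_apply, AlgHom.mul_apply, kron_self_apply_X] at this
    rw [this, aeval_X]

end Kronecker

theorem algTrdeg_adjoin_singleton {K A : Type*} [Field K] [CommRing A] [Algebra K A] {z : A}
    (hz : Transcendental K z) : algTrdeg K ↥(Algebra.adjoin K {z}) = 1 := by
  have h := (Polynomial.algEquivOfTranscendental K z hz).lift_trdeg_eq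
  rw [Polynomial.trdeg_of_isDomain, Cardinal.lift_one] at h
  have := Cardinal.lift_eq_one.1 h.symm
  rwa [Algebra.trdeg] at this

/-- If `K[x₁,…,xₙ]` is the coproduct of the images of idempotents `p i` and each of these images
is a polynomial ring in one variable `z i`, then the family `z` is a base. -/
theorem bijective_aeval_of_existsUnique {K σ : Type*} [Field K]
    (p : σ → MvPolynomial σ K →ₐ[K] MvPolynomial σ K) (hp : ∀ i, p i * p i = p i)
    (z : σ → MvPolynomial σ K) (hz : ∀ i, Transcendental K (z i))
    (hr : ∀ i, (p i).range = Algebra.adjoin K {z i})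
    (huniv : ∀ φ : σ → MvPolynomial σ K →ₐ[K] MvPolynomial σ K,
      ∃! ψ : MvPolynomial σ K →ₐ[K] MvPolynomial σ K, ∀ i, ψ * p i = φ i * p i) :
    Function.Bijective (aeval (R := K) z) := by
  have hpz : ∀ i, p i (z i) = z i := by
    intro i
    have : z i ∈ (p i).range := by rw [hr]; exact Algebra.self_mem_adjoin_singleton K _
    obtain ⟨a, ha⟩ := this
    rw [← ha]
    exact DFunLike.congr_fun (hp i) a
  have hφ : ∀ i, ∃ φ : MvPolynomial σ K →ₐ[K] MvPolynomial σ K, φ (z i) = X i := by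
    intro i
    refine ⟨((Polynomial.aeval (X i)).comp
      ((Polynomial.algEquivOfTranscendental K (z i) (hz i)).symm : _ →ₐ[K] Polynomial K)).comp
      ((p i).codRestrict (Algebra.adjoin K {z i}) fun a => hr i ▸ ⟨a, rfl⟩), ?_⟩
    have : (p i).codRestrict (Algebra.adjoin K {z i}) (fun a => hr i ▸ ⟨a, rfl⟩) (z i) =
        ⟨z i, Algebra.self_mem_adjoin_singleton K _⟩ := Subtype.ext (hpz i)
    rw [AlgHom.comp_apply, this, AlgHom.comp_apply]
    simp
  choose φ hφ using hφ
  obtain ⟨τ, hτ, -⟩ := huniv φ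
  have hτz : ∀ i, τ (z i) = X i := by
    intro i
    have := DFunLike.congr_fun (hτ i) (z i)
    rwa [AlgHom.mul_apply, AlgHom.mul_apply, hpz, hφ] at this
  have hτσ : τ.comp (aeval z) = AlgHom.id K _ := by
    ext i : 1
    simp [hτz]
  have hστ : aeval z * τ = 1 := by
    refine (huniv fun _ => 1).unique (fun i => AlgHom.ext fun a => ?_) fun _ => rfl
    have hle : Algebra.adjoin K {z i} ≤ AlgHom.equalizer (aeval z * τ) 1 := by
      rw [Algebra.adjoin_le_iff, Set.singleton_subset_iff]
      simp [hτz]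
    exact hle (hr i ▸ ⟨a, rfl⟩)
  exact Function.bijective_iff_has_inverse.2
    ⟨τ, fun a => DFunLike.congr_fun hτσ a, fun a => DFunLike.congr_fun hστ a⟩

/-- The images `Φ(e_{ij})` of the Kronecker endomorphisms under an automorphism `Φ` of
`End K[x₁,…,xₙ]` form a base of `End K[x₁,…,xₙ]`: they satisfy the Kronecker relations,
have rank `1`, and the images of the `Φ(e_{ii})` lie in `K[z_i]` for some base `z₁,…,zₙ`. -/
theorem stmt_14 (K : Type) [Field K] (n : ℕ) (hn : 2 ≤ n)
    (Φ : (MvPolynomial (Fin n) K →ₐ[K] MvPolynomial (Fin n) K) ≃*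
         (MvPolynomial (Fin n) K →ₐ[K] MvPolynomial (Fin n) K)) :
    (∀ i j k l : Fin n, j = k → (Φ (kron K n i j)).comp (Φ (kron K n k l)) = Φ (kron K n i l)) ∧
    (∀ i j : Fin n, algTrdeg K ↥(Φ (kron K n i j)).range = 1) ∧
    (∃ z : Fin n → MvPolynomial (Fin n) K,
        Function.Bijective ⇑(MvPolynomial.aeval (R := K) z) ∧
        ∀ i, (Φ (kron K n i i)).range ≤ Algebra.adjoin K {z i}) := by
  have : NeZero n := ⟨by omega⟩
  have hΦ : ∀ {c : MvPolynomial (Fin n) K →ₐ[K] MvPolynomial (Fin n) K},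
      (∀ φ, φ * Φ c = Φ c) ↔ ∀ φ, φ * c = c := by
    intro c
    rw [Φ.surjective.forall]
    simp only [← map_mul, Φ.injective.eq_iff]
  have hmul : ∀ i j l, Φ (kron K n i j) * Φ (kron K n j l) = Φ (kron K n i l) := by
    intro i j l
    rw [← map_mul, kron_mul_kron]
  have hz : ∀ i, ∃ z, Transcendental K z ∧ (Φ (kron K n i i)).range = Algebra.adjoin K {z} := by
    intro i
    refine exists_range_eq_adjoin_singleton _ (hmul i i i) ?_ ?_
    · rw [hΦ]
      exact not_forall_mul_kron_self_eq i
    · intro θ hθ φ ψ h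
      obtain ⟨θ, rfl⟩ := Φ.surjective θ
      obtain ⟨φ, rfl⟩ := Φ.surjective φ
      obtain ⟨ψ, rfl⟩ := Φ.surjective ψ
      rw [← map_mul, hΦ] at hθ
      rw [← map_mul, ← map_mul, ← map_mul, ← map_mul, Φ.injective.eq_iff] at h
      rw [← map_mul, ← map_mul, kron_self_cancel i θ hθ φ ψ h]
  choose z hz hr using hz
  refine ⟨?_, fun i j => ?_, z, ?_, fun i => (hr i).le⟩
  · rintro i j _ l rfl
    exact hmul i j l
  · have : (Φ (kron K n i j)).range = (Φ (kron K n i i)).range := by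
      apply le_antisymm
      · rw [← hmul i i j]
        exact AlgHom.range_comp_le_range _ _
      · rw [← hmul i j i]
        exact AlgHom.range_comp_le_range _ _
    rw [this, hr i]
    exact algTrdeg_adjoin_singleton (hz i)
  · refine bijective_aeval_of_existsUnique (fun i => Φ (kron K n i i)) (fun i => hmul i i i) z hz hr
      fun φ => ?_
    obtain ⟨ψ, hψ, hu⟩ := existsUnique_mul_kron_self fun i => Φ.symm (φ i)
    refine ⟨Φ ψ, fun i => ?_, fun χ hχ => ?_⟩
    · rw [← map_mul, hψ, map_mul, Φ.apply_symm_apply]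
    · rw [← hu (Φ.symm χ) fun i => ?_, Φ.apply_symm_apply]
      apply Φ.injective
      rw [map_mul, map_mul, Φ.apply_symm_apply, Φ.apply_symm_apply]
      exact hχ i
end
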